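/- Let d ≥ 1 and let Y be a d×d real symmetric positive definite matrix. Let μ = e^{-V(x)} dx and ν = e^{-W(x)} dx be probability measures on ℝ^d, where V, W : ℝ^d → ℝ are twice continuously differentiable, W is convex, and the Legendre transform W* is finite and twice continuously differentiable on ℝ^d. Assume there are constants Λ_V, λ_W > 0 such that ⟨∇²V(x), Y⟩ ≤ Λ_V and ⟨∇²W*(x), Y⟩ ≤ 1/λ_W for all x ∈ ℝ^d, where ⟨A,B⟩ := Tr(BᵀA). Let φ : ℝ^d → ℝ be a twice continuously differentiable convex function whose gradient pushes μ forward to ν. Then ⟨∇²φ(x), Y⟩ ≤ √(Λ_V/λ_W) for every x ∈ ℝ^d. -/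

import Mathlib

open MeasureTheory Matrix
open scoped RealInnerProductSpace

/-- The Hessian matrix of `f : ℝ^d → ℝ` at `x`, with entries the second derivatives
in the coordinate directions. -/
noncomputable def hessianMatrix {d : ℕ} (f : EuclideanSpace ℝ (Fin d) → ℝ)
    (x : EuclideanSpace ℝ (Fin d)) : Matrix (Fin d) (Fin d) ℝ :=
  Matrix.of fun i j =>
    iteratedFDeriv ℝ 2 f x ![EuclideanSpace.single i (1:ℝ), EuclideanSpace.single j (1:ℝ)]

/-- The Frobenius inner product `⟨A, B⟩ = Tr(Bᵀ A)`. -/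
def frob {d : ℕ} (A B : Matrix (Fin d) (Fin d) ℝ) : ℝ := (Bᵀ * A).trace

/-- The weight `4 (1 - ‖u‖²)₊` on the unit ball. -/
noncomputable def ballWeight {d : ℕ} (u : EuclideanSpace ℝ (Fin d)) : ℝ :=
  4 * max (1 - ‖u‖ ^ 2) 0

/-- The weight `(1 - ‖u‖²)₊²`, whose gradient is `-ballWeight u • u`. -/
noncomputable def ballPotential {d : ℕ} (u : EuclideanSpace ℝ (Fin d)) : ℝ :=
  max (1 - ‖u‖ ^ 2) 0 ^ 2

section Weights

variable {d : ℕ}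

lemma ballWeight_nonneg (u : EuclideanSpace ℝ (Fin d)) : 0 ≤ ballWeight u := by
  unfold ballWeight; positivity

lemma ballPotential_nonneg (u : EuclideanSpace ℝ (Fin d)) : 0 ≤ ballPotential u := by
  unfold ballPotential; positivity

lemma max_one_sub_norm_sq_le_one (u : EuclideanSpace ℝ (Fin d)) : max (1 - ‖u‖ ^ 2) 0 ≤ 1 :=
  max_le (by nlinarith [norm_nonneg u]) zero_le_one

lemma ballWeight_le_four (u : EuclideanSpace ℝ (Fin d)) : ballWeight u ≤ 4 := by
  unfold ballWeight; linarith [max_one_sub_norm_sq_le_one u]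

lemma ballPotential_le_ballWeight (u : EuclideanSpace ℝ (Fin d)) :
    ballPotential u ≤ ballWeight u := by
  unfold ballWeight ballPotential
  nlinarith [max_one_sub_norm_sq_le_one u, le_max_right (1 - ‖u‖ ^ 2) 0]

lemma ballWeight_sq (u : EuclideanSpace ℝ (Fin d)) :
    ballWeight u ^ 2 = 16 * ballPotential u := by
  unfold ballWeight ballPotential; ring

lemma ballWeight_eq_zero {u : EuclideanSpace ℝ (Fin d)} (hu : 1 ≤ ‖u‖) : ballWeight u = 0 := by
  unfold ballWeight
  rw [max_eq_right (by nlinarith), mul_zero]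

lemma ballPotential_eq_zero {u : EuclideanSpace ℝ (Fin d)} (hu : 1 ≤ ‖u‖) :
    ballPotential u = 0 := by
  unfold ballPotential
  rw [max_eq_right (by nlinarith), zero_pow two_ne_zero]

lemma continuous_ballWeight : Continuous (ballWeight (d := d)) := by
  unfold ballWeight; fun_prop

lemma continuous_ballPotential : Continuous (ballPotential (d := d)) := by
  unfold ballPotential; fun_prop

lemma hasCompactSupport_ballWeight : HasCompactSupport (ballWeight (d := d)) :=
  HasCompactSupport.intro (isCompact_closedBall 0 1) fun u hu ↦
    ballWeight_eq_zero (by simpa using (not_le.1 (by simpa using hu) : 1 < ‖u‖).le)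

lemma hasCompactSupport_ballPotential : HasCompactSupport (ballPotential (d := d)) :=
  HasCompactSupport.intro (isCompact_closedBall 0 1) fun u hu ↦
    ballPotential_eq_zero (by simpa using (not_le.1 (by simpa using hu) : 1 < ‖u‖).le)

lemma integrable_mul_ballWeight {f : EuclideanSpace ℝ (Fin d) → ℝ} (hf : Continuous f) :
    Integrable fun u ↦ f u * ballWeight u :=
  (hf.mul continuous_ballWeight).integrable_of_hasCompactSupport
    hasCompactSupport_ballWeight.mul_left

lemma integrable_mul_ballPotential {f : EuclideanSpace ℝ (Fin d) → ℝ} (hf : Continuous f) :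
    Integrable fun u ↦ f u * ballPotential u :=
  (hf.mul continuous_ballPotential).integrable_of_hasCompactSupport
    hasCompactSupport_ballPotential.mul_left

lemma integrable_ballWeight : Integrable (ballWeight (d := d)) :=
  continuous_ballWeight.integrable_of_hasCompactSupport hasCompactSupport_ballWeight

lemma integrable_ballPotential : Integrable (ballPotential (d := d)) :=
  continuous_ballPotential.integrable_of_hasCompactSupport hasCompactSupport_ballPotential

lemma integral_ballPotential_pos : 0 < ∫ u, ballPotential (d := d) u := by
  refine continuous_ballPotential.integral_pos_of_hasCompactSupport_nonneg_nonzero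
    hasCompactSupport_ballPotential ballPotential_nonneg (x := 0) ?_
  simp [ballPotential]

lemma integral_ballWeight_pos : 0 < ∫ u, ballWeight (d := d) u :=
  integral_ballPotential_pos.trans_le
    (integral_mono integrable_ballPotential integrable_ballWeight ballPotential_le_ballWeight)

lemma hasDerivAt_max_zero_sq (s : ℝ) :
    HasDerivAt (fun s : ℝ ↦ max s 0 ^ 2) (2 * max s 0) s := by
  rcases lt_trichotomy s 0 with hs | rfl | hs
  · rw [max_eq_right hs.le, mul_zero]
    refine (hasDerivAt_const s (0 : ℝ)).congr_of_eventuallyEq ?_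
    filter_upwards [eventually_lt_nhds hs] with r hr
    rw [max_eq_right hr.le]; norm_num
  · rw [hasDerivAt_iff_isLittleO]
    simp only [max_self, sub_zero, mul_zero, smul_zero, ne_eq, OfNat.ofNat_ne_zero,
      not_false_eq_true, zero_pow]
    have hO : (fun r : ℝ ↦ max r 0 ^ 2) =O[nhds 0] fun r : ℝ ↦ r ^ 2 := by
      refine Asymptotics.IsBigO.of_bound 1 (Filter.Eventually.of_forall fun r ↦ ?_)
      rw [one_mul, norm_pow, norm_pow]
      gcongr
      rw [Real.norm_eq_abs, Real.norm_eq_abs, abs_of_nonneg (le_max_right _ _)]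
      exact max_le (le_abs_self r) (abs_nonneg r)
    refine hO.trans_isLittleO ?_
    simpa using Asymptotics.isLittleO_pow_pow (𝕜 := ℝ) (m := 1) (n := 2) one_lt_two
  · rw [max_eq_left hs.le]
    have := hasDerivAt_pow 2 s
    simp only [Nat.cast_ofNat, Nat.add_one_sub_one, pow_one] at this
    refine this.congr_of_eventuallyEq ?_
    filter_upwards [eventually_gt_nhds hs] with r hr
    rw [max_eq_left hr.le]

lemma hasFDerivAt_ballPotential (u : EuclideanSpace ℝ (Fin d)) :
    HasFDerivAt ballPotential (-(ballWeight u) • innerSL ℝ u) u := by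
  have h1 : HasFDerivAt (fun u : EuclideanSpace ℝ (Fin d) ↦ 1 - ‖u‖ ^ 2)
      (-(2 • (innerSL ℝ u))) u := by
    simpa using (hasStrictFDerivAt_norm_sq u).hasFDerivAt.const_sub 1
  refine ((hasDerivAt_max_zero_sq (1 - ‖u‖ ^ 2)).comp_hasFDerivAt u h1).congr_fderiv ?_
  ext v
  simp [ballWeight]
  ring

/-- Differentiation under the integral sign against a compactly supported weight. -/
lemma hasDerivAt_integral_mul_weight {k k' : ℝ → EuclideanSpace ℝ (Fin d) → ℝ}
    {g : EuclideanSpace ℝ (Fin d) → ℝ} (hg : Continuous g) (hgc : HasCompactSupport g)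
    (hk : ∀ s, Continuous (k s)) (hk' : Continuous fun p : ℝ × EuclideanSpace ℝ (Fin d) ↦ k' p.1 p.2)
    (hd : ∀ s u, HasDerivAt (fun s ↦ k s u) (k' s u) s) (s : ℝ) :
    HasDerivAt (fun s ↦ ∫ u, k s u * g u) (∫ u, k' s u * g u) s := by
  obtain ⟨C, hC⟩ := ((isCompact_closedBall s 1).prod hgc.isCompact).exists_bound_of_continuousOn
    hk'.continuousOn
  have hks : ∀ s, Continuous (k' s) := fun s ↦ hk'.comp (Continuous.prodMk_right s)
  refine (hasDerivAt_integral_of_dominated_loc_of_deriv_le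
    (F := fun s u ↦ k s u * g u) (F' := fun s u ↦ k' s u * g u) (𝕜 := ℝ)
    (bound := fun u ↦ C * |g u|) (Metric.closedBall_mem_nhds s one_pos) ?_ ?_ ?_ ?_ ?_ ?_).2
  · exact Filter.Eventually.of_forall fun s ↦ ((hk s).mul hg).aestronglyMeasurable
  · exact ((hk s).mul hg).integrable_of_hasCompactSupport hgc.mul_left
  · exact ((hks s).mul hg).aestronglyMeasurable
  · refine Filter.Eventually.of_forall fun u r hr ↦ ?_
    rw [norm_mul, ← Real.norm_eq_abs]
    by_cases hu : u ∈ tsupport g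
    · gcongr
      exact hC (r, u) ⟨hr, hu⟩
    · simp [image_eq_zero_of_notMem_tsupport hu]
  · exact ((hg.integrable_of_hasCompactSupport hgc).abs).const_mul C
  · exact Filter.Eventually.of_forall fun u r _ ↦ (hd r u).mul_const (g u)

end Weights

section Derivatives

variable {d : ℕ} {f : EuclideanSpace ℝ (Fin d) → ℝ}

lemma ContDiff.hasFDerivAt_of_two (hf : ContDiff ℝ 2 f) (x : EuclideanSpace ℝ (Fin d)) :
    HasFDerivAt f (fderiv ℝ f x) x :=
  (hf.differentiable two_ne_zero x).hasFDerivAt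

lemma ContDiff.contDiff_fderiv_of_two (hf : ContDiff ℝ 2 f) : ContDiff ℝ 1 (fderiv ℝ f) :=
  hf.fderiv_right (by norm_num)

lemma ContDiff.hasFDerivAt_fderiv_of_two (hf : ContDiff ℝ 2 f) (x : EuclideanSpace ℝ (Fin d)) :
    HasFDerivAt (fderiv ℝ f) (fderiv ℝ (fderiv ℝ f) x) x :=
  (hf.contDiff_fderiv_of_two.differentiable one_ne_zero x).hasFDerivAt

lemma ContDiff.continuous_fderiv_fderiv_of_two (hf : ContDiff ℝ 2 f) :
    Continuous (fderiv ℝ (fderiv ℝ f)) :=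
  hf.contDiff_fderiv_of_two.continuous_fderiv one_ne_zero

/-- `t ↦ f (x + t u)` has derivative `Df(x + t u) u`. -/
lemma ContDiff.hasDerivAt_ray (hf : ContDiff ℝ 2 f) (x u : EuclideanSpace ℝ (Fin d)) (t : ℝ) :
    HasDerivAt (fun t : ℝ ↦ f (x + t • u)) (fderiv ℝ f (x + t • u) u) t := by
  have h : HasDerivAt (fun t : ℝ ↦ x + t • u) u t := by
    simpa using ((hasDerivAt_id t).smul_const u).const_add x
  exact (hf.hasFDerivAt_of_two _).comp_hasDerivAt t h

lemma ContDiff.hasDerivAt_fderiv_ray (hf : ContDiff ℝ 2 f) (x u v : EuclideanSpace ℝ (Fin d))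
    (t : ℝ) :
    HasDerivAt (fun t : ℝ ↦ fderiv ℝ f (x + t • u) v)
      (fderiv ℝ (fderiv ℝ f) (x + t • u) u v) t := by
  have h : HasDerivAt (fun t : ℝ ↦ x + t • u) u t := by
    simpa using ((hasDerivAt_id t).smul_const u).const_add x
  have h2 := (hf.hasFDerivAt_fderiv_of_two (x + t • u)).comp_hasDerivAt t h
  simpa using h2.clm_apply (hasDerivAt_const t v)

lemma laplacian_eq_sum_fderiv (f : EuclideanSpace ℝ (Fin d) → ℝ) (x : EuclideanSpace ℝ (Fin d)) :
    Laplacian.laplacian f x = ∑ i, fderiv ℝ (fderiv ℝ f) x (EuclideanSpace.single i (1 : ℝ))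
      (EuclideanSpace.single i (1 : ℝ)) := by
  rw [InnerProductSpace.laplacian_eq_iteratedFDeriv_orthonormalBasis f (EuclideanSpace.basisFun (Fin d) ℝ)]
  simp [iteratedFDeriv_two_apply]

lemma ContDiff.continuous_laplacian_of_two (hf : ContDiff ℝ 2 f) :
    Continuous (Laplacian.laplacian f) := by
  have h := hf.continuous_fderiv_fderiv_of_two
  rw [show Laplacian.laplacian f = _ from funext (laplacian_eq_sum_fderiv f)]
  fun_prop

/-- Green identity on the ball of radius `t` around `x`. -/
lemma integral_fderiv_ray_mul_ballWeight (hf : ContDiff ℝ 2 f) (x : EuclideanSpace ℝ (Fin d))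
    (t : ℝ) :
    ∫ u, fderiv ℝ f (x + t • u) u * ballWeight u =
      t * ∫ u, Laplacian.laplacian f (x + t • u) * ballPotential u := by
  have hcf : Continuous fun u : EuclideanSpace ℝ (Fin d) ↦ fderiv ℝ f (x + t • u) :=
    hf.contDiff_fderiv_of_two.continuous.comp (by fun_prop)
  have hcf2 : Continuous fun u : EuclideanSpace ℝ (Fin d) ↦ fderiv ℝ (fderiv ℝ f) (x + t • u) :=
    hf.continuous_fderiv_fderiv_of_two.comp (by fun_prop)
  have key : ∀ v : EuclideanSpace ℝ (Fin d),
      ∫ u, fderiv ℝ f (x + t • u) v * (⟪u, v⟫ * ballWeight u) =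
        ∫ u, t * (fderiv ℝ (fderiv ℝ f) (x + t • u) v v * ballPotential u) := by
    intro v
    have hdf : ∀ u : EuclideanSpace ℝ (Fin d), HasFDerivAt (fun u ↦ fderiv ℝ f (x + t • u) v)
        (t • (fderiv ℝ (fderiv ℝ f) (x + t • u)).flip v) u := by
      intro u
      have h1 : HasFDerivAt (fun u : EuclideanSpace ℝ (Fin d) ↦ x + t • u)
          (t • ContinuousLinearMap.id ℝ _) u := ((hasFDerivAt_id u).const_smul t).const_add x
      have h2 := (hf.hasFDerivAt_fderiv_of_two (x + t • u)).comp u h1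
      refine (h2.clm_apply (hasFDerivAt_const v u)).congr_fderiv ?_
      ext w
      simp
    have := integral_bilinear_hasFDerivAt_right_eq_neg_left_of_integrable
      (μ := (volume : Measure (EuclideanSpace ℝ (Fin d))))
      (B := ContinuousLinearMap.mul ℝ ℝ) (v := v)
      (f := fun u ↦ fderiv ℝ f (x + t • u) v)
      (f' := fun u ↦ t • (fderiv ℝ (fderiv ℝ f) (x + t • u)).flip v)
      (g := ballPotential) (g' := fun u ↦ -(ballWeight u) • innerSL ℝ u)
      ?_ ?_ ?_ (fun u _ ↦ hdf u) (fun u _ ↦ hasFDerivAt_ballPotential u)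
    · simp only [ContinuousLinearMap.mul_apply', _root_.smul_apply,
        innerSL_apply_apply, smul_eq_mul, ContinuousLinearMap.flip_apply] at this
      rw [← neg_inj, ← integral_neg]
      simp only [mul_assoc] at this
      rw [← this]
      congr 1; ext u; ring
    · refine integrable_mul_ballPotential (f := fun u ↦
        t * fderiv ℝ (fderiv ℝ f) (x + t • u) v v) (by fun_prop)
    · refine (integrable_mul_ballWeight (f := fun u ↦ -(fderiv ℝ f (x + t • u) v * ⟪u, v⟫))
        (by fun_prop)).congr (Filter.Eventually.of_forall fun u ↦ ?_)
      simp; ring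
    · exact integrable_mul_ballPotential (by fun_prop)
  have hsum : ∀ u : EuclideanSpace ℝ (Fin d), fderiv ℝ f (x + t • u) u * ballWeight u =
      ∑ i, fderiv ℝ f (x + t • u) (EuclideanSpace.single i (1 : ℝ)) *
        (⟪u, EuclideanSpace.single i (1 : ℝ)⟫ * ballWeight u) := by
    intro u
    have hu : u = ∑ i, ⟪u, EuclideanSpace.single i (1 : ℝ)⟫ • EuclideanSpace.single i (1 : ℝ) := by
      have := (EuclideanSpace.basisFun (Fin d) ℝ).sum_repr' u
      simp only [EuclideanSpace.basisFun_apply] at this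
      conv_lhs => rw [← this]
      simp only [real_inner_comm]
    conv_lhs => rw [hu]; simp only [map_sum, map_smul, Finset.sum_mul, smul_eq_mul]
    rw [← hu]
    refine Finset.sum_congr rfl fun i _ ↦ ?_
    ring
  simp_rw [hsum]
  rw [integral_finsetSum]
  · simp_rw [key, laplacian_eq_sum_fderiv, Finset.sum_mul]
    rw [integral_finsetSum]
    · rw [Finset.mul_sum]
      simp_rw [integral_const_mul]
    · exact fun i _ ↦ integrable_mul_ballPotential (by fun_prop)
  · intro i _
    simp_rw [← mul_assoc]
    exact integrable_mul_ballWeight (by fun_prop)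

/-- The derivative in the radius of the weighted ball average. -/
lemma hasDerivAt_integral_ray (hf : ContDiff ℝ 2 f) (x : EuclideanSpace ℝ (Fin d)) (t : ℝ) :
    HasDerivAt (fun t : ℝ ↦ ∫ u, f (x + t • u) * ballWeight u)
      (∫ u, fderiv ℝ f (x + t • u) u * ballWeight u) t := by
  have h1 := hf.continuous
  have h2 := hf.contDiff_fderiv_of_two.continuous
  exact hasDerivAt_integral_mul_weight (k := fun t u ↦ f (x + t • u))
    (k' := fun t u ↦ fderiv ℝ f (x + t • u) u) continuous_ballWeight
    hasCompactSupport_ballWeight (fun t ↦ by fun_prop) (by fun_prop)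
    (fun t u ↦ hf.hasDerivAt_ray x u t) t

/-- A function with Laplacian at most `Λ` has controlled weighted ball averages. -/
lemma integral_ray_mul_ballWeight_le (hf : ContDiff ℝ 2 f) {Λ : ℝ}
    (hΛ : ∀ x, Laplacian.laplacian f x ≤ Λ) (x : EuclideanSpace ℝ (Fin d)) {t : ℝ} (ht : 0 ≤ t) :
    ∫ u, f (x + t • u) * ballWeight u ≤
      f x * (∫ u, ballWeight (d := d) u) + t ^ 2 / 2 * Λ * ∫ u, ballPotential (d := d) u := by
  have hder : ∀ s : ℝ, HasDerivAt (fun t : ℝ ↦ (∫ u, f (x + t • u) * ballWeight u) -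
      t ^ 2 / 2 * Λ * ∫ u, ballPotential (d := d) u)
      (s * (∫ u, Laplacian.laplacian f (x + s • u) * ballPotential u) -
        s * Λ * ∫ u, ballPotential (d := d) u) s := by
    intro s
    rw [← integral_fderiv_ray_mul_ballWeight hf]
    refine (hasDerivAt_integral_ray hf x s).sub ?_
    have h2 := (((hasDerivAt_pow 2 s).div_const 2).mul_const Λ).mul_const
      (∫ u, ballPotential (d := d) u)
    refine h2.congr_deriv ?_
    simp
  have hanti : AntitoneOn (fun t : ℝ ↦ (∫ u, f (x + t • u) * ballWeight u) -
      t ^ 2 / 2 * Λ * ∫ u, ballPotential (d := d) u) (Set.Ici 0) := by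
    refine antitoneOn_of_hasDerivWithinAt_nonpos (convex_Ici 0)
      (fun s _ ↦ (hder s).continuousAt.continuousWithinAt)
      (fun s _ ↦ (hder s).hasDerivWithinAt) fun s hs ↦ ?_
    rw [interior_Ici, Set.mem_Ioi] at hs
    rw [mul_assoc, ← mul_sub, ← integral_const_mul]
    refine mul_nonpos_of_nonneg_of_nonpos hs.le (sub_nonpos.2 ?_)
    refine integral_mono (integrable_mul_ballPotential ?_) (integrable_ballPotential.const_mul Λ)
      fun u ↦ mul_le_mul_of_nonneg_right (hΛ _) (ballPotential_nonneg u)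
    exact hf.continuous_laplacian_of_two.comp (by fun_prop)
  have := hanti (Set.mem_Ici.2 le_rfl) (Set.mem_Ici.2 ht) ht
  have h0 : ∫ u : EuclideanSpace ℝ (Fin d), f (x + (0 : ℝ) • u) * ballWeight u =
      f x * ∫ u, ballWeight (d := d) u := by
    simp only [zero_smul, add_zero, integral_const_mul]
  simp only [h0] at this
  linarith

end Derivatives

section LinearAlgebra

variable {d : ℕ}

open scoped MatrixOrder in
lemma Matrix.PosDef.exists_eq_mul_transpose {H : Matrix (Fin d) (Fin d) ℝ} (hH : H.PosDef) :
    ∃ A : Matrix (Fin d) (Fin d) ℝ, IsUnit A ∧ H = A * Aᵀ := by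
  obtain ⟨B, rfl⟩ := CStarAlgebra.nonneg_iff_eq_star_mul_self.mp hH.posSemidef.nonneg
  refine ⟨Bᵀ, ?_, by simp [star_eq_conjTranspose]⟩
  have h := hH.isUnit
  rw [Matrix.isUnit_iff_isUnit_det] at h ⊢
  rw [det_mul] at h
  rw [det_transpose]
  exact isUnit_of_mul_isUnit_right h

lemma Matrix.PosDef.log_det_le_trace_sub {M : Matrix (Fin d) (Fin d) ℝ} (hM : M.PosDef) :
    Real.log M.det ≤ M.trace - d := by
  rw [hM.isHermitian.det_eq_prod_eigenvalues, hM.isHermitian.trace_eq_sum_eigenvalues]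
  simp only [RCLike.ofReal_real_eq_id, id_eq]
  rw [Real.log_prod fun i _ ↦ (hM.eigenvalues_pos i).ne']
  calc ∑ i, Real.log (hM.isHermitian.eigenvalues i)
      ≤ ∑ i, (hM.isHermitian.eigenvalues i - 1) :=
        Finset.sum_le_sum fun i _ ↦ Real.log_le_sub_one_of_pos (hM.eigenvalues_pos i)
    _ = _ := by simp

/-- Concavity of `log det`, in the form of the tangent inequality at `H`. -/
lemma Matrix.PosDef.exists_log_det_le {H : Matrix (Fin d) (Fin d) ℝ} (hH : H.PosDef) :
    ∃ C : Matrix (Fin d) (Fin d) ℝ, Cᵀ * H * C = 1 ∧ ∀ M : Matrix (Fin d) (Fin d) ℝ, M.PosDef →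
      Real.log M.det ≤ Real.log H.det + (Cᵀ * M * C).trace - d := by
  obtain ⟨A, hA, rfl⟩ := hH.exists_eq_mul_transpose
  have hdet : IsUnit A.det := (Matrix.isUnit_iff_isUnit_det A).1 hA
  have hone : A⁻¹ * (A * Aᵀ) * A⁻¹ᵀ = 1 := by
    rw [← mul_assoc, nonsing_inv_mul A hdet, one_mul, ← transpose_mul, nonsing_inv_mul A hdet,
      transpose_one]
  refine ⟨A⁻¹ᵀ, by rwa [transpose_transpose], fun M hM ↦ ?_⟩
  rw [transpose_transpose]
  have hinj : Function.Injective (A⁻¹ᵀ).mulVec := by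
    rw [Matrix.mulVec_injective_iff_isUnit, Matrix.isUnit_iff_isUnit_det, det_transpose]
    exact isUnit_nonsing_inv_det A hdet
  have hP : (A⁻¹ * M * A⁻¹ᵀ).PosDef := by
    have := hM.conjTranspose_mul_mul_same (B := A⁻¹ᵀ) hinj
    simpa using this
  have h1 := hP.log_det_le_trace_sub
  have h2 := congrArg Matrix.det hone
  rw [det_mul, det_mul, det_one] at h2
  have hi : A⁻¹.det ≠ 0 := (isUnit_nonsing_inv_det A hdet).ne_zero
  have h3 : M.det = (A * Aᵀ).det * (A⁻¹ * M * A⁻¹ᵀ).det := by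
    rw [det_mul (A⁻¹ * M), det_mul (A⁻¹) M]
    linear_combination (-M.det) * h2
  rw [h3, Real.log_mul hH.det_pos.ne' hP.det_pos.ne']
  linarith

variable {f : EuclideanSpace ℝ (Fin d) → ℝ}

lemma hessianMatrix_apply (f : EuclideanSpace ℝ (Fin d) → ℝ) (x : EuclideanSpace ℝ (Fin d))
    (i j : Fin d) :
    hessianMatrix f x i j = fderiv ℝ (fderiv ℝ f) x (EuclideanSpace.single i (1 : ℝ))
      (EuclideanSpace.single j (1 : ℝ)) := by
  simp [hessianMatrix, iteratedFDeriv_two_apply]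

lemma laplacian_eq_trace_hessianMatrix (f : EuclideanSpace ℝ (Fin d) → ℝ)
    (x : EuclideanSpace ℝ (Fin d)) :
    Laplacian.laplacian f x = (hessianMatrix f x).trace := by
  simp [laplacian_eq_sum_fderiv, Matrix.trace, hessianMatrix_apply]

lemma EuclideanSpace.eq_sum_smul_single (v : EuclideanSpace ℝ (Fin d)) :
    v = ∑ i, v i • EuclideanSpace.single i (1 : ℝ) := by
  have := (EuclideanSpace.basisFun (Fin d) ℝ).sum_repr v
  simpa using this.symm

lemma fderiv_fderiv_eq_dotProduct (f : EuclideanSpace ℝ (Fin d) → ℝ)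
    (x v w : EuclideanSpace ℝ (Fin d)) :
    fderiv ℝ (fderiv ℝ f) x v w = v.ofLp ⬝ᵥ (hessianMatrix f x *ᵥ w.ofLp) := by
  conv_lhs => rw [EuclideanSpace.eq_sum_smul_single v, EuclideanSpace.eq_sum_smul_single w]
  simp only [map_sum, map_smul, _root_.sum_apply, _root_.smul_apply,
    smul_eq_mul, dotProduct, mulVec, hessianMatrix_apply, Finset.mul_sum]
  rw [Finset.sum_comm]
  refine Finset.sum_congr rfl fun i _ ↦ Finset.sum_congr rfl fun j _ ↦ ?_
  ring

lemma trace_transpose_mul_hessianMatrix_mul (f : EuclideanSpace ℝ (Fin d) → ℝ)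
    (x : EuclideanSpace ℝ (Fin d)) (C : Matrix (Fin d) (Fin d) ℝ) :
    (Cᵀ * hessianMatrix f x * C).trace =
      ∑ i, fderiv ℝ (fderiv ℝ f) x (WithLp.toLp 2 (Cᵀ i)) (WithLp.toLp 2 (Cᵀ i)) := by
  simp only [Matrix.trace, diag_apply, fderiv_fderiv_eq_dotProduct]
  refine Finset.sum_congr rfl fun i _ ↦ ?_
  rw [mul_assoc, mul_apply_eq_vecMul, dotProduct_mulVec]
  simp [vecMul, Matrix.mul_apply, dotProduct, Finset.mul_sum, Finset.sum_mul]
  rw [Finset.sum_comm]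
  refine Finset.sum_congr rfl fun i _ ↦ Finset.sum_congr rfl fun j _ ↦ ?_
  ring

end LinearAlgebra

section Moments

variable {d : ℕ}

lemma integral_inner_mul_ballWeight (a : EuclideanSpace ℝ (Fin d)) :
    ∫ u, ⟪a, u⟫ * ballWeight u = 0 := by
  have h1 : fderiv ℝ (fun u : EuclideanSpace ℝ (Fin d) ↦ ⟪a, u⟫) = fun _ ↦ innerSL ℝ a := by
    ext u : 1
    exact (innerSL ℝ a).hasFDerivAt.fderiv
  have hL : ∀ x, Laplacian.laplacian (fun u : EuclideanSpace ℝ (Fin d) ↦ ⟪a, u⟫) x = 0 := by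
    intro x
    rw [laplacian_eq_sum_fderiv, h1]
    simp
  have := integral_fderiv_ray_mul_ballWeight (f := fun u : EuclideanSpace ℝ (Fin d) ↦ ⟪a, u⟫)
    (innerSL ℝ a).contDiff 0 1
  simpa [hL, h1] using this

lemma integral_inner_sq_mul_ballWeight (a : EuclideanSpace ℝ (Fin d)) :
    ∫ u, ⟪a, u⟫ ^ 2 * ballWeight u = ‖a‖ ^ 2 * ∫ u, ballPotential (d := d) u := by
  have h1 : fderiv ℝ (fun u : EuclideanSpace ℝ (Fin d) ↦ ⟪a, u⟫ ^ 2 / 2) =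
      fun u ↦ ⟪a, u⟫ • innerSL ℝ a := by
    ext u v
    have h := (((innerSL ℝ a).hasFDerivAt (x := u)).pow 2).mul_const (2⁻¹ : ℝ)
    have h' := h.fderiv
    simp only [innerSL_apply_apply, ← div_eq_mul_inv] at h'
    rw [h']
    simp
    ring
  have h2 : ∀ x v, fderiv ℝ (fderiv ℝ (fun u : EuclideanSpace ℝ (Fin d) ↦ ⟪a, u⟫ ^ 2 / 2)) x v =
      ⟪a, v⟫ • innerSL ℝ a := by
    intro x v
    rw [h1]
    have := ((innerSL ℝ a).hasFDerivAt (x := x)).smul_const (innerSL ℝ a)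
    simp only [innerSL_apply_apply] at this
    rw [this.fderiv]
    simp
  have hL : ∀ x : EuclideanSpace ℝ (Fin d),
      Laplacian.laplacian (fun u : EuclideanSpace ℝ (Fin d) ↦ (⟪a, u⟫ ^ 2 / 2 : ℝ)) x =
      ‖a‖ ^ 2 := by
    intro x
    simp only [laplacian_eq_sum_fderiv, h2, _root_.smul_apply, innerSL_apply_apply,
      EuclideanSpace.real_norm_sq_eq]
    simp [EuclideanSpace.inner_single_right, sq]
  have := integral_fderiv_ray_mul_ballWeight
    (f := fun u : EuclideanSpace ℝ (Fin d) ↦ ⟪a, u⟫ ^ 2 / 2)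
    (((innerSL ℝ a).contDiff.pow 2).div_const 2) 0 1
  simp only [hL, h1, integral_const_mul] at this
  simpa [← sq] using this

/-- The ball weight can be tilted in the direction of a given vector. -/
lemma exists_tilt (a : EuclideanSpace ℝ (Fin d)) :
    ∃ e : EuclideanSpace ℝ (Fin d), ‖e‖ ≤ 1 ∧
      ∫ u, ((1 + ⟪e, u⟫) * ballWeight u) = ∫ u, ballWeight (d := d) u ∧
      ∫ u, (⟪a, u⟫ * (1 + ⟪e, u⟫)) * ballWeight u = ‖a‖ * ∫ u, ballPotential (d := d) u := by
  set e : EuclideanSpace ℝ (Fin d) := ‖a‖⁻¹ • a with he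
  have ha : a = ‖a‖ • e := by
    rcases eq_or_ne a 0 with h | h
    · simp [h]
    · rw [he, smul_smul, mul_inv_cancel₀ (norm_ne_zero_iff.2 h), one_smul]
  have hn : ‖a‖ * ‖e‖ ^ 2 = ‖a‖ := by
    rcases eq_or_ne a 0 with h | h
    · simp [h]
    · rw [he, norm_smul, norm_inv, norm_norm, inv_mul_cancel₀ (norm_ne_zero_iff.2 h)]
      simp
  refine ⟨e, ?_, ?_, ?_⟩
  · rw [he, norm_smul, norm_inv, norm_norm]
    exact inv_mul_le_one
  · simp_rw [add_mul, one_mul]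
    rw [integral_add integrable_ballWeight (integrable_mul_ballWeight (by fun_prop)),
      integral_inner_mul_ballWeight, add_zero]
  · have : ∀ u : EuclideanSpace ℝ (Fin d), (⟪a, u⟫ * (1 + ⟪e, u⟫)) * ballWeight u =
        ⟪a, u⟫ * ballWeight u + ‖a‖ * (⟪e, u⟫ ^ 2 * ballWeight u) := by
      intro u
      have : ⟪a, u⟫ = ‖a‖ * ⟪e, u⟫ := by
        conv_lhs => rw [ha, real_inner_smul_left]
      rw [this]; ring
    simp_rw [this]
    rw [integral_add (integrable_mul_ballWeight (by fun_prop))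
      ((integrable_mul_ballWeight (by fun_prop)).const_mul _), integral_inner_mul_ballWeight,
      integral_const_mul, integral_inner_sq_mul_ballWeight, zero_add, ← mul_assoc, hn]

/-- The tilted weight is nonnegative and at most twice the ball weight. -/
lemma tilt_mem {e u : EuclideanSpace ℝ (Fin d)} (he : ‖e‖ ≤ 1) :
    0 ≤ (1 + ⟪e, u⟫) * ballWeight u ∧ (1 + ⟪e, u⟫) * ballWeight u ≤ 2 * ballWeight u := by
  rcases le_total 1 ‖u‖ with hu | hu
  · simp [ballWeight_eq_zero hu]
  · have h : |⟪e, u⟫| ≤ 1 :=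
      (abs_real_inner_le_norm e u).trans (mul_le_one₀ he (norm_nonneg u) hu)
    obtain ⟨h1, h2⟩ := abs_le.1 h
    have := ballWeight_nonneg u
    constructor
    · exact mul_nonneg (by linarith) this
    · exact mul_le_mul_of_nonneg_right (by linarith) this

end Moments

section Bounds

variable {d : ℕ}

lemma integral_linear_combination_two {f g : EuclideanSpace ℝ (Fin d) → ℝ} (hf : Integrable f)
    (hg : Integrable g) (a b : ℝ) :
    ∫ u, (a * f u + b * g u) = a * (∫ u, f u) + b * ∫ u, g u := by
  rw [integral_add (hf.const_mul a) (hg.const_mul b), integral_const_mul, integral_const_mul]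

lemma integral_linear_combination_three {f g h : EuclideanSpace ℝ (Fin d) → ℝ} (hf : Integrable f)
    (hg : Integrable g) (hh : Integrable h) (a b c : ℝ) :
    ∫ u, (a * f u + b * g u + c * h u) = a * (∫ u, f u) + b * (∫ u, g u) + c * ∫ u, h u := by
  rw [integral_add (f := fun u ↦ a * f u + b * g u) ((hf.const_mul a).add (hg.const_mul b))
    (hh.const_mul c), integral_linear_combination_two hf hg, integral_const_mul]

lemma inner_gradient_eq_fderiv (f : EuclideanSpace ℝ (Fin d) → ℝ)
    (x v : EuclideanSpace ℝ (Fin d)) : ⟪gradient f x, v⟫ = fderiv ℝ f x v := by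
  rw [← toDual_gradient]
  rfl

lemma ContDiff.continuous_gradient_of_two {f : EuclideanSpace ℝ (Fin d) → ℝ}
    (hf : ContDiff ℝ 2 f) : Continuous (gradient f) :=
  (InnerProductSpace.toDual ℝ (EuclideanSpace ℝ (Fin d))).symm.continuous.comp
    hf.contDiff_fderiv_of_two.continuous

/-- A differentiable convex function lies above its tangent hyperplanes. -/
lemma ConvexOn.add_fderiv_le {f : EuclideanSpace ℝ (Fin d) → ℝ} (hc : ConvexOn ℝ Set.univ f)
    (hf : ContDiff ℝ 2 f) (x y : EuclideanSpace ℝ (Fin d)) :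
    f x + fderiv ℝ f x (y - x) ≤ f y := by
  have h1 : ConvexOn ℝ Set.univ fun t : ℝ ↦ f (x + t • (y - x)) := by
    have h := hc.comp_affineMap (AffineMap.lineMap (k := ℝ) x y)
    refine h.congr fun t _ ↦ ?_
    simp [AffineMap.lineMap_apply, add_comm]
  have h2 := hf.hasDerivAt_ray x (y - x) 0
  have h3 := h1.le_slope_of_hasDerivAt (Set.mem_univ 0) (Set.mem_univ 1) one_pos h2
  simp [slope_def_field] at h3
  rw [map_sub]
  linarith

/-- If `e^{-V}` is integrable and `ΔV` is bounded above, then `V` is bounded below. -/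
lemma exists_lower_bound_of_laplacian_le {V : EuclideanSpace ℝ (Fin d) → ℝ} (hV : ContDiff ℝ 2 V)
    {Λ : ℝ} (hΛ : ∀ x, Laplacian.laplacian V x ≤ Λ)
    (hV_int : Integrable fun x ↦ Real.exp (-V x)) : ∃ C, ∀ x, -C ≤ V x := by
  set N := ∫ u, ballWeight (d := d) u with hN
  set K := ∫ u, ballPotential (d := d) u with hK
  have hN0 : 0 < N := integral_ballWeight_pos
  set I := ∫ x, Real.exp (-V x) with hI
  refine ⟨4 * I / N + Λ * K / (2 * N), fun x ↦ ?_⟩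
  have hcV := hV.continuous
  have hmean := integral_ray_mul_ballWeight_le hV hΛ x zero_le_one
  simp only [one_smul] at hmean
  set m := V x + Λ * K / (2 * N) with hm
  have hmN : ∫ u, V (x + u) * ballWeight u ≤ m * N := by
    refine hmean.trans (le_of_eq ?_)
    rw [hm]; field_simp; ring
  have hlow : Real.exp (-m) * N ≤ ∫ u, Real.exp (-V (x + u)) * ballWeight u := by
    calc Real.exp (-m) * N
        ≤ ∫ u, (Real.exp (-m) * (1 + m)) * ballWeight u
            - Real.exp (-m) * (V (x + u) * ballWeight u) := by
          rw [integral_sub (integrable_ballWeight.const_mul _)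
            ((integrable_mul_ballWeight (by fun_prop)).const_mul _), integral_const_mul,
            integral_const_mul]
          have := mul_le_mul_of_nonneg_left hmN (Real.exp_pos (-m)).le
          nlinarith
      _ ≤ _ := by
          refine integral_mono ((integrable_ballWeight.const_mul _).sub
            ((integrable_mul_ballWeight (by fun_prop)).const_mul _))
            (integrable_mul_ballWeight (by fun_prop)) fun u ↦ ?_
          have h1 : Real.exp (-V (x + u)) ≥ Real.exp (-m) * (1 + m - V (x + u)) := by
            have : Real.exp (-V (x + u)) = Real.exp (-m) * Real.exp (m - V (x + u)) := by
              rw [← Real.exp_add]; ring_nf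
            rw [this]
            refine mul_le_mul_of_nonneg_left ?_ (Real.exp_pos _).le
            linarith [Real.add_one_le_exp (m - V (x + u))]
          have := mul_le_mul_of_nonneg_right h1 (ballWeight_nonneg u)
          simp only
          linarith
  have hup : ∫ u, Real.exp (-V (x + u)) * ballWeight u ≤ 4 * I := by
    have htr : ∫ u, Real.exp (-V (x + u)) = I :=
      integral_add_left_eq_self (fun x ↦ Real.exp (-V x)) x
    rw [← htr, ← integral_const_mul]
    refine integral_mono (integrable_mul_ballWeight (by fun_prop))
      ((hV_int.comp_add_left x).const_mul 4) fun u ↦ ?_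
    have := mul_le_mul_of_nonneg_left (ballWeight_le_four u) (Real.exp_pos (-V (x + u))).le
    simp only
    linarith
  have h1 : Real.exp (-m) ≤ 4 * I / N := by
    rw [le_div_iff₀ hN0]; linarith
  have h2 := Real.add_one_le_exp (-m)
  linarith

/-- If the conjugate has Laplacian bounded above, the function grows quadratically. -/
lemma exists_quadratic_lower_bound {W Ws : EuclideanSpace ℝ (Fin d) → ℝ} (hWs : ContDiff ℝ 2 Ws)
    {Λ : ℝ} (hΛ0 : 0 < Λ) (hΛ : ∀ y, Laplacian.laplacian Ws y ≤ Λ)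
    (hyoung : ∀ q y, ⟪q, y⟫ ≤ W q + Ws y) :
    ∃ c C, 0 < c ∧ 0 ≤ C ∧ ∀ q, c * ‖q‖ ^ 2 ≤ W q + C := by
  set N := ∫ u, ballWeight (d := d) u with hN
  set K := ∫ u, ballPotential (d := d) u with hK
  have hN0 : 0 < N := integral_ballWeight_pos
  have hK0 : 0 < K := integral_ballPotential_pos
  refine ⟨K / (4 * Λ * N), |2 * Ws 0 + (|W 0|)|, by positivity, abs_nonneg _, fun q ↦ ?_⟩
  obtain ⟨e, he, hmass, hmom⟩ := exists_tilt q
  rw [← hN] at hmass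
  rw [← hK] at hmom
  set s := ‖q‖ / (2 * Λ) with hs
  have hs0 : 0 ≤ s := by positivity
  have hcont := hWs.continuous
  have hWs0 : ∀ y, 0 ≤ Ws y + |W 0| := fun y ↦ by
    have := hyoung 0 y
    rw [inner_zero_left] at this
    linarith [le_abs_self (W 0)]
  have hpt : ∀ u : EuclideanSpace ℝ (Fin d), s * ((⟪q, u⟫ * (1 + ⟪e, u⟫)) * ballWeight u) ≤
      ((W q - |W 0|) * ((1 + ⟪e, u⟫) * ballWeight u) + (2 * |W 0|) * ballWeight u)
        + 2 * (Ws (0 + s • u) * ballWeight u) := by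
    intro u
    obtain ⟨h1, h2⟩ := tilt_mem (u := u) he
    have h3 := hyoung q (s • u)
    rw [real_inner_smul_right] at h3
    have h4 := mul_le_mul_of_nonneg_right h3 h1
    have h5 := mul_le_mul_of_nonneg_left h2 (hWs0 (s • u))
    rw [zero_add]
    linarith
  have hint1 : Integrable fun u : EuclideanSpace ℝ (Fin d) ↦ (1 + ⟪e, u⟫) * ballWeight u :=
    integrable_mul_ballWeight (by fun_prop)
  have hmono := integral_mono
    ((integrable_mul_ballWeight (f := fun u ↦ ⟪q, u⟫ * (1 + ⟪e, u⟫)) (by fun_prop)).const_mul s)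
    (((hint1.const_mul (W q - |W 0|)).add (integrable_ballWeight.const_mul (2 * |W 0|))).add
      ((integrable_mul_ballWeight (f := fun u ↦ Ws (0 + s • u)) (by fun_prop)).const_mul 2)) hpt
  simp only [Pi.add_apply] at hmono
  rw [integral_linear_combination_three hint1 integrable_ballWeight
    (integrable_mul_ballWeight (f := fun u ↦ Ws (0 + s • u)) (by fun_prop)), integral_const_mul,
    hmass, hmom] at hmono
  have hmean := integral_ray_mul_ballWeight_le hWs hΛ 0 hs0
  rw [← hN, ← hK] at hmean
  have h6 : s * (‖q‖ * K) - s ^ 2 * Λ * K ≤ (W q + (2 * Ws 0 + |W 0|)) * N := by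
    linarith
  have h7 : s * (‖q‖ * K) - s ^ 2 * Λ * K = (K / (4 * Λ * N) * ‖q‖ ^ 2) * N := by
    rw [hs]; field_simp; ring
  rw [h7] at h6
  have h8 := le_of_mul_le_mul_right h6 hN0
  linarith [le_abs_self (2 * Ws 0 + |W 0|)]

/-- A convex function whose gradient has dense range grows superlinearly. -/
lemma exists_superlinear_bound (hd : 1 ≤ d) {φ : EuclideanSpace ℝ (Fin d) → ℝ}
    (hφ : ContDiff ℝ 2 φ) (hc : ConvexOn ℝ Set.univ φ) (hdense : DenseRange (gradient φ)) (M : ℝ)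
    (hM : 0 ≤ M) : ∃ C, ∀ x, M * ‖x‖ - C ≤ φ x := by
  have hone : ∀ y : EuclideanSpace ℝ (Fin d), ∃ C, ∀ x, ⟪y, x⟫ - ‖x‖ - C ≤ φ x := by
    intro y
    obtain ⟨z, hz⟩ := hdense.exists_dist_lt y one_pos
    refine ⟨fderiv ℝ φ z z - φ z, fun x ↦ ?_⟩
    have h1 := hc.add_fderiv_le hφ z x
    rw [map_sub, ← inner_gradient_eq_fderiv φ z x] at h1
    have h2 : ⟪y, x⟫ - ⟪gradient φ z, x⟫ ≤ ‖x‖ := by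
      rw [← inner_sub_left]
      refine (real_inner_le_norm _ _).trans ?_
      rw [dist_eq_norm] at hz
      exact mul_le_of_le_one_left (norm_nonneg x) hz.le
    linarith
  choose C hC using hone
  have hdpos : (0 : ℝ) < d := by exact_mod_cast hd
  set R : ℝ := d * (M + 1) with hR
  have hR0 : 0 ≤ R := by positivity
  refine ⟨(∑ i : Fin d, max (C (R • EuclideanSpace.single i (1 : ℝ)))
    (C (-(R • EuclideanSpace.single i (1 : ℝ))))) / d, fun x ↦ ?_⟩
  have hcoord : ∀ i : Fin d, R * |x i| ≤ φ x + ‖x‖ + max (C (R • EuclideanSpace.single i (1 : ℝ)))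
      (C (-(R • EuclideanSpace.single i (1 : ℝ)))) := by
    intro i
    have h1 := hC (R • EuclideanSpace.single i (1 : ℝ)) x
    have h2 := hC (-(R • EuclideanSpace.single i (1 : ℝ))) x
    rw [inner_neg_left] at h2
    rw [real_inner_smul_left, EuclideanSpace.inner_single_left] at h1 h2
    simp only [map_one, one_mul] at h1 h2
    have h3 := le_max_left (C (R • EuclideanSpace.single i (1 : ℝ)))
      (C (-(R • EuclideanSpace.single i (1 : ℝ))))
    have h4 := le_max_right (C (R • EuclideanSpace.single i (1 : ℝ)))
      (C (-(R • EuclideanSpace.single i (1 : ℝ))))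
    rcases abs_cases (x i) with ⟨h, _⟩ | ⟨h, _⟩ <;> rw [h] <;> linarith
  have hnorm : ‖x‖ ≤ ∑ i, |x i| := by
    conv_lhs => rw [EuclideanSpace.eq_sum_smul_single x]
    refine (norm_sum_le _ _).trans (Finset.sum_le_sum fun i _ ↦ ?_)
    simp [norm_smul]
  have hsum := Finset.sum_le_sum fun i (_ : i ∈ Finset.univ) ↦ hcoord i
  rw [← Finset.mul_sum, Finset.sum_add_distrib] at hsum
  simp only [Finset.sum_const, Finset.card_univ, Fintype.card_fin, nsmul_eq_mul] at hsum
  have h5 := mul_le_mul_of_nonneg_left hnorm hR0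
  rw [sub_le_iff_le_add, ← sub_le_iff_le_add', le_div_iff₀ hdpos]
  nlinarith

end Bounds

/-- The data of a smooth transport problem between `e^{-V}` and `e^{-W}`, where `φ` solves the
Monge–Ampère equation and the Laplacians of `V` and of the conjugate `Ws` of `W` are bounded. -/
structure LaplacianBoundedTransport {d : ℕ} (V W Ws φ : EuclideanSpace ℝ (Fin d) → ℝ)
    (Λ Λ' : ℝ) : Prop where
  one_le_dim : 1 ≤ d
  contDiff_source : ContDiff ℝ 2 V
  contDiff_conjugate : ContDiff ℝ 2 Ws
  contDiff_potential : ContDiff ℝ 2 φ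
  convex_potential : ConvexOn ℝ Set.univ φ
  integrable_exp : Integrable fun x ↦ Real.exp (-V x)
  young : ∀ q y, ⟪q, y⟫ ≤ W q + Ws y
  attained : ∀ q, ∃ y, W q + Ws y = ⟪q, y⟫
  source_pos : 0 < Λ
  conjugate_pos : 0 < Λ'
  laplacian_source_le : ∀ x, Laplacian.laplacian V x ≤ Λ
  laplacian_conjugate_le : ∀ y, Laplacian.laplacian Ws y ≤ Λ'
  posDef_hessian : ∀ x, (hessianMatrix φ x).PosDef
  mongeAmpere : ∀ x, V x = W (gradient φ x) - Real.log (hessianMatrix φ x).det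
  denseRange_gradient : DenseRange (gradient φ)

namespace LaplacianBoundedTransport

variable {d : ℕ} {V W Ws φ : EuclideanSpace ℝ (Fin d) → ℝ} {Λ Λ' : ℝ}

lemma norm_sq_gradient_le (h : LaplacianBoundedTransport V W Ws φ Λ Λ') :
    ∃ c C, 0 < c ∧ 0 ≤ C ∧ ∀ z, 0 ≤ V z + C ∧
      c * ‖gradient φ z‖ ^ 2 ≤ V z + C + Laplacian.laplacian φ z := by
  obtain ⟨CV, hCV⟩ := exists_lower_bound_of_laplacian_le h.contDiff_source
    h.laplacian_source_le h.integrable_exp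
  obtain ⟨c, CW, hc, hCW, hW⟩ := exists_quadratic_lower_bound h.contDiff_conjugate
    h.conjugate_pos h.laplacian_conjugate_le h.young
  refine ⟨c, |CV| + CW, hc, by positivity, fun z ↦ ⟨?_, ?_⟩⟩
  · linarith [hCV z, le_abs_self CV]
  · have h1 := hW (gradient φ z)
    have h2 := (h.posDef_hessian z).log_det_le_trace_sub
    rw [← laplacian_eq_trace_hessianMatrix] at h2
    have h3 := h.mongeAmpere z
    have h4 : (0 : ℝ) ≤ d := Nat.cast_nonneg d
    linarith [abs_nonneg CV]

lemma continuous_gradient (h : LaplacianBoundedTransport V W Ws φ Λ Λ') :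
    Continuous (gradient φ) := h.contDiff_potential.continuous_gradient_of_two

lemma integral_norm_gradient_le (h : LaplacianBoundedTransport V W Ws φ Λ Λ') :
    ∃ C, 0 ≤ C ∧ ∀ T, 1 ≤ T → ∫ u, ‖gradient φ (T • u)‖ * ballWeight u ≤ C * T := by
  obtain ⟨c, C, hc, hC, hcC⟩ := h.norm_sq_gradient_le
  set N := ∫ u, ballWeight (d := d) u with hN
  set K := ∫ u, ballPotential (d := d) u with hK
  have hN0 : 0 < N := integral_ballWeight_pos
  have hK0 : 0 < K := integral_ballPotential_pos
  have hg := h.continuous_gradient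
  have hcV := h.contDiff_source.continuous
  have hcφ := h.contDiff_potential.contDiff_fderiv_of_two.continuous
  have hcL := h.contDiff_potential.continuous_laplacian_of_two
  set B : ℝ := ∫ u, (Metric.closedBall (0 : EuclideanSpace ℝ (Fin d)) 1).indicator 1 u with hB
  have hBint : Integrable
      ((Metric.closedBall (0 : EuclideanSpace ℝ (Fin d)) 1).indicator (1 : EuclideanSpace ℝ (Fin d) → ℝ)) :=
    (integrable_indicator_iff Metric.isClosed_closedBall.measurableSet).2
      (integrableOn_const (isCompact_closedBall _ _).measure_lt_top.ne)
  have hB0 : 0 ≤ B := integral_nonneg fun u ↦ Set.indicator_nonneg (by simp) u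
  set A := (V 0 + C) * N + Λ * K / 2 with hA
  have hA0 : 0 ≤ A := by
    have := (hcC 0).1
    have := h.source_pos
    positivity
  set C₁ := 2 / c * (A + 8 * B / c) with hC₁
  have hC₁0 : 0 ≤ C₁ := by positivity
  refine ⟨C₁ + 4 * B, by positivity, fun T hT ↦ ?_⟩
  have hT0 : 0 < T := by linarith
  set X := ∫ u, ‖gradient φ (T • u)‖ ^ 2 * ballPotential u with hX
  set Z := ∫ u, ‖gradient φ (T • u)‖ * ballWeight u with hZ
  have hXint : Integrable fun u ↦ ‖gradient φ (T • u)‖ ^ 2 * ballPotential u :=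
    integrable_mul_ballPotential (by fun_prop)
  have hZint : Integrable fun u ↦ ‖gradient φ (T • u)‖ * ballWeight u :=
    integrable_mul_ballWeight (by fun_prop)
  have hZ0 : 0 ≤ Z := integral_nonneg fun u ↦ mul_nonneg (norm_nonneg _) (ballWeight_nonneg u)
  have hyoung : ∀ δ : ℝ, 0 < δ → Z ≤ δ * X + 4 / δ * B := by
    intro δ hδ
    rw [hX, hB, ← integral_linear_combination_two hXint hBint]
    refine integral_mono hZint ((hXint.const_mul δ).add (hBint.const_mul (4 / δ))) fun u ↦ ?_
    set a := ‖gradient φ (T • u)‖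
    simp only
    by_cases hu : u ∈ Metric.closedBall (0 : EuclideanSpace ℝ (Fin d)) 1
    · rw [Set.indicator_of_mem hu, Pi.one_apply]
      have h1 := ballWeight_sq u
      have h2 : δ * (a ^ 2 * ballPotential u) + 4 / δ * 1 - a * ballWeight u
          = (δ * a * ballWeight u / 4 - 2) ^ 2 / δ := by
        field_simp
        linear_combination (-δ ^ 2 * a ^ 2) * h1
      have h3 : 0 ≤ (δ * a * ballWeight u / 4 - 2) ^ 2 / δ := by positivity
      linarith
    · have hu' : 1 ≤ ‖u‖ := by
        simp only [Metric.mem_closedBall, dist_zero_right, not_le] at hu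
        exact hu.le
      simp [Set.indicator_of_notMem hu, ballWeight_eq_zero hu', ballPotential_eq_zero hu']
  have hgreen : ∫ u, Laplacian.laplacian φ (T • u) * ballPotential u ≤ Z := by
    have h1 := integral_fderiv_ray_mul_ballWeight h.contDiff_potential 0 T
    simp only [zero_add] at h1
    have h2 : ∫ u, fderiv ℝ φ (T • u) u * ballWeight u ≤ Z := by
      refine integral_mono (integrable_mul_ballWeight (by fun_prop)) hZint fun u ↦ ?_
      simp only
      rcases le_total 1 ‖u‖ with hu | hu
      · simp [ballWeight_eq_zero hu]
      · refine mul_le_mul_of_nonneg_right ?_ (ballWeight_nonneg u)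
        rw [← inner_gradient_eq_fderiv]
        exact (real_inner_le_norm _ _).trans (mul_le_of_le_one_right (norm_nonneg _) hu)
    rw [h1] at h2
    by_contra! h3
    nlinarith
  have hmean := integral_ray_mul_ballWeight_le h.contDiff_source h.laplacian_source_le 0 hT0.le
  simp only [zero_add] at hmean
  have hcX : c * X ≤ A * T ^ 2 + Z := by
    have hVint : Integrable fun u ↦ V (T • u) * ballWeight u :=
      integrable_mul_ballWeight (by fun_prop)
    have hLint : Integrable fun u ↦ Laplacian.laplacian φ (T • u) * ballPotential u :=
      integrable_mul_ballPotential (by fun_prop)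
    have h1 : c * X ≤ 1 * (∫ u, V (T • u) * ballWeight u) + C * N
        + 1 * ∫ u, Laplacian.laplacian φ (T • u) * ballPotential u := by
      rw [hX, hN, ← integral_linear_combination_three hVint integrable_ballWeight hLint,
        ← integral_const_mul]
      refine integral_mono (hXint.const_mul c)
        (((hVint.const_mul 1).add (integrable_ballWeight.const_mul C)).add (hLint.const_mul 1))
        fun u ↦ ?_
      obtain ⟨h2, h3⟩ := hcC (T • u)
      have h4 := mul_le_mul_of_nonneg_right h3 (ballPotential_nonneg u)
      have h5 := mul_le_mul_of_nonneg_left (ballPotential_le_ballWeight u) h2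
      simp only
      linarith
    have h6 : (V 0 + C) * N ≤ (V 0 + C) * N * T ^ 2 :=
      le_mul_of_one_le_right (mul_nonneg (hcC 0).1 hN0.le) (one_le_pow₀ hT)
    rw [hA]
    linarith
  have hX1 : X ≤ C₁ * T ^ 2 := by
    have h1 := hyoung (c / 2) (by positivity)
    have h2 : 4 / (c / 2) * B = 8 * B / c := by field_simp; ring
    have h3 : 8 * B / c ≤ 8 * B / c * T ^ 2 :=
      le_mul_of_one_le_right (by positivity) (one_le_pow₀ hT)
    have h4 : c / 2 * X ≤ c / 2 * (C₁ * T ^ 2) := by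
      have : c / 2 * (C₁ * T ^ 2) = (A + 8 * B / c) * T ^ 2 := by rw [hC₁]; field_simp
      rw [this]
      linarith
    exact le_of_mul_le_mul_left h4 (by positivity)
  have h5 := hyoung (1 / T) (by positivity)
  have h6 : 1 / T * X ≤ C₁ * T := by
    rw [one_div, inv_mul_le_iff₀ hT0]
    linarith
  have h7 : 4 / (1 / T) * B = 4 * B * T := by field_simp
  linarith

/-- The transport map grows at most linearly. -/
lemma norm_gradient_le (h : LaplacianBoundedTransport V W Ws φ Λ Λ') :
    ∃ C, 0 ≤ C ∧ ∀ x, ‖gradient φ x‖ ≤ C * (1 + ‖x‖) := by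
  obtain ⟨C, hC, hCT⟩ := h.integral_norm_gradient_le
  set N := ∫ u, ballWeight (d := d) u with hN
  set K := ∫ u, ballPotential (d := d) u with hK
  have hN0 : 0 < N := integral_ballWeight_pos
  have hK0 : 0 < K := integral_ballPotential_pos
  have hKN : K ≤ N :=
    integral_mono integrable_ballPotential integrable_ballWeight ballPotential_le_ballWeight
  have hg := h.continuous_gradient
  set D := 2 * (N / K) + 1 with hD
  have hD0 : 0 < D := by positivity
  refine ⟨2 * (D + 1) * (C * D) / K, by positivity, fun x ↦ ?_⟩
  set p := gradient φ x with hp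
  set r := ‖x‖ with hr
  have hr0 : 0 ≤ r := norm_nonneg x
  set T := 2 * (N / K) * r + 1 with hT
  have hT1 : 1 ≤ T := by
    have : 0 ≤ 2 * (N / K) * r := by positivity
    linarith
  obtain ⟨e, he, hmass, hmom⟩ := exists_tilt p
  rw [← hN] at hmass
  rw [← hK] at hmom
  have hpt : ∀ u : EuclideanSpace ℝ (Fin d),
      T * ((⟪p, u⟫ * (1 + ⟪e, u⟫)) * ballWeight u) + -⟪p, x⟫ * ((1 + ⟪e, u⟫) * ballWeight u) ≤
        (2 * (T + r)) * (‖gradient φ (T • u)‖ * ballWeight u) := by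
    intro u
    rcases le_total 1 ‖u‖ with hu | hu
    · simp [ballWeight_eq_zero hu]
    obtain ⟨h1, h2⟩ := tilt_mem (u := u) he
    have h3 := h.convex_potential.add_fderiv_le h.contDiff_potential x (T • u)
    have h4 := h.convex_potential.add_fderiv_le h.contDiff_potential (T • u) x
    rw [← inner_gradient_eq_fderiv] at h3 h4
    have h5 : ⟪gradient φ (T • u), x - T • u⟫ ≥ -(‖gradient φ (T • u)‖ * (T + r)) := by
      have h6 := (abs_le.1 (abs_real_inner_le_norm (gradient φ (T • u)) (x - T • u))).1
      have h7 : ‖x - T • u‖ ≤ T + r := by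
        refine (norm_sub_le _ _).trans ?_
        rw [norm_smul, Real.norm_of_nonneg (by linarith)]
        nlinarith
      have := mul_le_mul_of_nonneg_left h7 (norm_nonneg (gradient φ (T • u)))
      linarith
    rw [← hp, inner_sub_right, real_inner_smul_right] at h3
    have h8 : T * ⟪p, u⟫ - ⟪p, x⟫ ≤ ‖gradient φ (T • u)‖ * (T + r) := by linarith
    have h9 := mul_le_mul_of_nonneg_right h8 h1
    have h10 := mul_le_mul_of_nonneg_left h2
      (by positivity : 0 ≤ ‖gradient φ (T • u)‖ * (T + r))
    linarith
  have hint1 : Integrable fun u : EuclideanSpace ℝ (Fin d) ↦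
      (⟪p, u⟫ * (1 + ⟪e, u⟫)) * ballWeight u := integrable_mul_ballWeight (by fun_prop)
  have hint2 : Integrable fun u : EuclideanSpace ℝ (Fin d) ↦ (1 + ⟪e, u⟫) * ballWeight u :=
    integrable_mul_ballWeight (by fun_prop)
  have hint3 : Integrable fun u ↦ ‖gradient φ (T • u)‖ * ballWeight u :=
    integrable_mul_ballWeight (by fun_prop)
  have hmono := integral_mono ((hint1.const_mul T).add (hint2.const_mul (-⟪p, x⟫)))
    (hint3.const_mul (2 * (T + r))) hpt
  simp only [Pi.add_apply] at hmono
  rw [integral_linear_combination_two hint1 hint2, integral_const_mul, hmass, hmom] at hmono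
  have hinner : ⟪p, x⟫ * N ≤ ‖p‖ * r * N :=
    mul_le_mul_of_nonneg_right (real_inner_le_norm p x) hN0.le
  have h1 := mul_le_mul_of_nonneg_left (hCT T hT1) (by positivity : 0 ≤ 2 * (T + r))
  have hTK : T * K = 2 * N * r + K := by rw [hT]; field_simp
  have h2 : ‖p‖ * (K * (1 + r)) ≤ 2 * (T + r) * (C * T) := by
    have h3 : ‖p‖ * (K * (1 + r)) ≤ ‖p‖ * (T * K - N * r) := by
      refine mul_le_mul_of_nonneg_left ?_ (norm_nonneg p)
      rw [hTK]
      nlinarith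
    linarith
  have hTD : T ≤ D * (1 + r) := by
    rw [hT, hD]
    have : 0 < N / K := by positivity
    nlinarith
  have h3 : 2 * (T + r) * (C * T) ≤ 2 * ((D + 1) * (1 + r)) * (C * (D * (1 + r))) := by
    have : T + r ≤ (D + 1) * (1 + r) := by linarith
    gcongr
  have h4 : ‖p‖ * K * (1 + r) ≤ 2 * (D + 1) * (C * D) * (1 + r) * (1 + r) := by linarith
  have h5 := le_of_mul_le_mul_right h4 (by positivity)
  rw [div_mul_eq_mul_div, le_div_iff₀ hK0]
  exact h5

end LaplacianBoundedTransport

/-- The second derivative is nonpositive at a global maximum. -/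
lemma second_deriv_nonpos_of_forall_le {f f' : ℝ → ℝ} {a : ℝ} (hf : ∀ s, HasDerivAt f (f' s) s)
    (hf' : HasDerivAt f' a 0) (hmax : ∀ s, f s ≤ f 0) : a ≤ 0 := by
  by_contra! ha
  have hderiv : deriv f = f' := funext fun s ↦ (hf s).deriv
  have hlocmax : IsLocalMax f 0 := Filter.Eventually.of_forall hmax
  have hmin : IsLocalMin f 0 := by
    refine isLocalMin_of_deriv_deriv_pos ?_ hlocmax.deriv_eq_zero (hf 0).continuousAt
    rwa [hderiv, hf'.deriv]
  have hconst : f =ᶠ[nhds 0] fun _ ↦ f 0 := by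
    filter_upwards [hmin] with s hs using le_antisymm (hmax s) hs
  have h1 : deriv f =ᶠ[nhds 0] fun _ ↦ 0 := by
    have := hconst.deriv
    simpa using this
  rw [hderiv] at h1
  have h2 := h1.deriv_eq
  rw [hf'.deriv] at h2
  simp at h2
  exact ha.ne' h2

section Ray

variable {d : ℕ}

lemma continuous_integral_ray {f : EuclideanSpace ℝ (Fin d) → ℝ} (hf : Continuous f) (t : ℝ) :
    Continuous fun x ↦ ∫ u, f (x + t • u) * ballWeight u := by
  have h1 : ∀ x, ∫ u, f (x + t • u) * ballWeight u =
      ∫ u in Metric.closedBall 0 1, f (x + t • u) * ballWeight u := fun x ↦ by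
    refine (setIntegral_eq_integral_of_forall_compl_eq_zero fun u hu ↦ ?_).symm
    simp only [Metric.mem_closedBall, dist_zero_right, not_le] at hu
    rw [ballWeight_eq_zero hu.le, mul_zero]
  simp_rw [h1]
  have := continuous_ballWeight (d := d)
  exact continuous_parametric_integral_of_continuous (by fun_prop) (isCompact_closedBall _ _)

end Ray

namespace LaplacianBoundedTransport

variable {d : ℕ} {V W Ws φ : EuclideanSpace ℝ (Fin d) → ℝ} {Λ Λ' : ℝ}

lemma exists_forall_le_penalized (h : LaplacianBoundedTransport V W Ws φ Λ Λ') {t ε : ℝ}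
    (ht : 0 ≤ t) (hε : 0 < ε) :
    ∃ x₀, ∀ x, (∫ u, φ (x + t • u) * ballWeight u) -
        (1 + ε) * (∫ u, ballWeight (d := d) u) * φ x ≤
      (∫ u, φ (x₀ + t • u) * ballWeight u) -
        (1 + ε) * (∫ u, ballWeight (d := d) u) * φ x₀ := by
  obtain ⟨C, hC, hgrow⟩ := h.norm_gradient_le
  set N := ∫ u, ballWeight (d := d) u with hN
  have hN0 : 0 < N := integral_ballWeight_pos
  have hcφ := h.contDiff_potential.continuous
  obtain ⟨C', hsup⟩ := exists_superlinear_bound h.one_le_dim h.contDiff_potential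
    h.convex_potential h.denseRange_gradient ((C * t + 1) / ε) (by positivity)
  have hup : ∀ x, (∫ u, φ (x + t • u) * ballWeight u) - (1 + ε) * N * φ x ≤
      N * (C * (1 + t) * t + ε * C') - N * ‖x‖ := by
    intro x
    have h1 : ∫ u, φ (x + t • u) * ballWeight u ≤
        ∫ u, (φ x + C * (1 + (‖x‖ + t)) * t) * ballWeight (d := d) u := by
      refine integral_mono (integrable_mul_ballWeight (by fun_prop))
        (integrable_ballWeight.const_mul _) fun u ↦ ?_
      simp only
      rcases le_total 1 ‖u‖ with hu | hu
      · simp [ballWeight_eq_zero hu]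
      refine mul_le_mul_of_nonneg_right ?_ (ballWeight_nonneg u)
      have h2 := h.convex_potential.add_fderiv_le h.contDiff_potential (x + t • u) x
      rw [← inner_gradient_eq_fderiv, show x - (x + t • u) = -(t • u) by abel, inner_neg_right,
        real_inner_smul_right] at h2
      have h3 : ‖x + t • u‖ ≤ ‖x‖ + t := by
        refine (norm_add_le _ _).trans ?_
        rw [norm_smul, Real.norm_of_nonneg ht]
        nlinarith
      have h4 : ⟪gradient φ (x + t • u), u⟫ ≤ C * (1 + (‖x‖ + t)) :=
        calc ⟪gradient φ (x + t • u), u⟫ ≤ ‖gradient φ (x + t • u)‖ * ‖u‖ :=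
              real_inner_le_norm _ _
          _ ≤ ‖gradient φ (x + t • u)‖ := mul_le_of_le_one_right (norm_nonneg _) hu
          _ ≤ C * (1 + ‖x + t • u‖) := hgrow _
          _ ≤ _ := by gcongr
      nlinarith
    rw [integral_const_mul] at h1
    have h2 := hsup x
    have h3 : (C * t + 1) * ‖x‖ - ε * C' ≤ ε * φ x := by
      have := mul_le_mul_of_nonneg_left h2 hε.le
      rw [mul_sub, ← mul_assoc, mul_div_cancel₀ _ hε.ne'] at this
      exact this
    have h4 := mul_le_mul_of_nonneg_left h3 hN0.le
    linarith
  refine Continuous.exists_forall_ge ?_ (Filter.tendsto_atBot_mono hup ?_)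
  · exact (continuous_integral_ray hcφ t).sub (by fun_prop)
  · simp_rw [sub_eq_add_neg]
    refine Filter.tendsto_atBot_add_const_left _ _ ?_
    exact Filter.tendsto_neg_atTop_atBot.comp
      ((tendsto_norm_cocompact_atTop (E := EuclideanSpace ℝ (Fin d))).const_mul_atTop hN0)

/-- First and second order optimality conditions at a maximum of the penalized functional. -/
lemma optimality (h : LaplacianBoundedTransport V W Ws φ Λ Λ') {t a : ℝ}
    {x₀ : EuclideanSpace ℝ (Fin d)}
    (hmax : ∀ x, (∫ u, φ (x + t • u) * ballWeight u) - a * φ x ≤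
      (∫ u, φ (x₀ + t • u) * ballWeight u) - a * φ x₀) (v : EuclideanSpace ℝ (Fin d)) :
    ∫ u, fderiv ℝ φ (x₀ + t • u) v * ballWeight u = a * fderiv ℝ φ x₀ v ∧
    ∫ u, fderiv ℝ (fderiv ℝ φ) (x₀ + t • u) v v * ballWeight u ≤
      a * fderiv ℝ (fderiv ℝ φ) x₀ v v := by
  have hφ := h.contDiff_potential
  have h0 := hφ.continuous
  have h1 := hφ.contDiff_fderiv_of_two.continuous
  have h2 := hφ.continuous_fderiv_fderiv_of_two
  have hd1 : ∀ s, HasDerivAt (fun s : ℝ ↦ (∫ u, φ ((x₀ + s • v) + t • u) * ballWeight u) -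
      a * φ (x₀ + s • v)) ((∫ u, fderiv ℝ φ ((x₀ + s • v) + t • u) v * ballWeight u) -
      a * fderiv ℝ φ (x₀ + s • v) v) s := by
    intro s
    refine HasDerivAt.sub ?_ ((hφ.hasDerivAt_ray x₀ v s).const_mul a)
    refine hasDerivAt_integral_mul_weight (k := fun s u ↦ φ ((x₀ + s • v) + t • u))
      (k' := fun s u ↦ fderiv ℝ φ ((x₀ + s • v) + t • u) v) continuous_ballWeight
      hasCompactSupport_ballWeight (fun s ↦ by fun_prop) (by fun_prop) (fun s u ↦ ?_) s
    have := hφ.hasDerivAt_ray (x₀ + t • u) v s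
    simpa only [add_right_comm] using this
  have hd2 : HasDerivAt (fun s : ℝ ↦ (∫ u, fderiv ℝ φ ((x₀ + s • v) + t • u) v * ballWeight u) -
      a * fderiv ℝ φ (x₀ + s • v) v)
      ((∫ u, fderiv ℝ (fderiv ℝ φ) ((x₀ + (0 : ℝ) • v) + t • u) v v * ballWeight u) -
      a * fderiv ℝ (fderiv ℝ φ) (x₀ + (0 : ℝ) • v) v v) 0 := by
    refine HasDerivAt.sub ?_ ((hφ.hasDerivAt_fderiv_ray x₀ v v 0).const_mul a)
    refine hasDerivAt_integral_mul_weight (k := fun s u ↦ fderiv ℝ φ ((x₀ + s • v) + t • u) v)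
      (k' := fun s u ↦ fderiv ℝ (fderiv ℝ φ) ((x₀ + s • v) + t • u) v v) continuous_ballWeight
      hasCompactSupport_ballWeight (fun s ↦ by fun_prop) (by fun_prop) (fun s u ↦ ?_) 0
    have := hφ.hasDerivAt_fderiv_ray (x₀ + t • u) v v s
    simpa only [add_right_comm] using this
  have hle : ∀ s : ℝ, (∫ u, φ ((x₀ + s • v) + t • u) * ballWeight u) - a * φ (x₀ + s • v) ≤
      (∫ u, φ ((x₀ + (0 : ℝ) • v) + t • u) * ballWeight u) - a * φ (x₀ + (0 : ℝ) • v) := by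
    intro s
    rw [zero_smul, add_zero]
    exact hmax _
  constructor
  · have := IsLocalMax.hasDerivAt_eq_zero (Filter.Eventually.of_forall hle) (hd1 0)
    rw [zero_smul, add_zero] at this
    linarith
  · have := second_deriv_nonpos_of_forall_le hd1 hd2 hle
    rw [zero_smul, add_zero] at this
    linarith

/-- At a maximum of the penalized functional, the averaged radial derivative is controlled. -/
lemma exists_integral_radial_le (h : LaplacianBoundedTransport V W Ws φ Λ Λ') :
    ∃ B, ∀ t ε : ℝ, 0 ≤ t → 0 < ε → ∀ x₀,
      (∀ x, (∫ u, φ (x + t • u) * ballWeight u) -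
          (1 + ε) * (∫ u, ballWeight (d := d) u) * φ x ≤
        (∫ u, φ (x₀ + t • u) * ballWeight u) -
          (1 + ε) * (∫ u, ballWeight (d := d) u) * φ x₀) →
      t * ∫ u, fderiv ℝ φ (x₀ + t • u) u * ballWeight u ≤
        t ^ 2 * (∫ u, ballPotential (d := d) u) * Real.sqrt (Λ * Λ') + ε * B := by
  obtain ⟨b, CW, hb, -, hW⟩ := exists_quadratic_lower_bound h.contDiff_conjugate
    h.conjugate_pos h.laplacian_conjugate_le h.young
  set N := ∫ u, ballWeight (d := d) u with hN
  set K := ∫ u, ballPotential (d := d) u with hK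
  have hN0 : 0 < N := integral_ballWeight_pos
  have hΛ := h.source_pos
  have hΛ' := h.conjugate_pos
  set R := Real.sqrt (Λ * Λ') with hR
  have hR0 : 0 < R := Real.sqrt_pos.2 (by positivity)
  have hR2 : R ^ 2 = Λ * Λ' := Real.sq_sqrt (by positivity)
  set c := Λ / R with hc
  have hc0 : 0 < c := by positivity
  refine ⟨N * (d + CW + W 0) / c, fun t ε ht hε x₀ hmax ↦ ?_⟩
  have hφ := h.contDiff_potential
  have h0 := hφ.continuous
  have h1 := hφ.contDiff_fderiv_of_two.continuous
  have h2 := hφ.continuous_fderiv_fderiv_of_two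
  have h3 := h.contDiff_source.continuous
  have h4 := h.contDiff_conjugate.continuous
  set p := gradient φ x₀ with hp
  obtain ⟨y₀, hy₀⟩ := h.attained p
  obtain ⟨S, hS1, hS⟩ := (h.posDef_hessian x₀).exists_log_det_le
  set v : Fin d → EuclideanSpace ℝ (Fin d) := fun i ↦ WithLp.toLp 2 (Sᵀ i) with hv
  set J := ∫ u, fderiv ℝ φ (x₀ + t • u) u * ballWeight u with hJ
  have hopt := h.optimality hmax
  have hpt : ∀ u : EuclideanSpace ℝ (Fin d),
      fderiv ℝ φ (x₀ + t • u) y₀ * ballWeight u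
        + (c * t) * (fderiv ℝ φ (x₀ + t • u) u * ballWeight u)
        + (d + V x₀ - W p) * ballWeight u ≤
      V (x₀ + t • u) * ballWeight u + Ws (y₀ + (c * t) • u) * ballWeight u
        + ∑ i, fderiv ℝ (fderiv ℝ φ) (x₀ + t • u) (v i) (v i) * ballWeight u := by
    intro u
    have e1 := h.mongeAmpere (x₀ + t • u)
    have e2 := h.mongeAmpere x₀
    have e3 := h.young (gradient φ (x₀ + t • u)) (y₀ + (c * t) • u)
    have e4 := hS _ (h.posDef_hessian (x₀ + t • u))
    rw [trace_transpose_mul_hessianMatrix_mul] at e4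
    rw [inner_add_right, real_inner_smul_right, inner_gradient_eq_fderiv,
      inner_gradient_eq_fderiv] at e3
    rw [← Finset.sum_mul]
    have e5 : fderiv ℝ φ (x₀ + t • u) y₀ + (c * t) * fderiv ℝ φ (x₀ + t • u) u
        + (d + V x₀ - W p) ≤ V (x₀ + t • u) + Ws (y₀ + (c * t) • u)
        + ∑ i, fderiv ℝ (fderiv ℝ φ) (x₀ + t • u) (v i) (v i) := by
      rw [e1, e2]
      linarith
    have := mul_le_mul_of_nonneg_right e5 (ballWeight_nonneg u)
    linarith
  have i1 : Integrable fun u ↦ fderiv ℝ φ (x₀ + t • u) y₀ * ballWeight u :=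
    integrable_mul_ballWeight (by fun_prop)
  have i2 : Integrable fun u ↦ fderiv ℝ φ (x₀ + t • u) u * ballWeight u :=
    integrable_mul_ballWeight (by fun_prop)
  have i3 : Integrable fun u ↦ V (x₀ + t • u) * ballWeight u :=
    integrable_mul_ballWeight (by fun_prop)
  have i4 : Integrable fun u ↦ Ws (y₀ + (c * t) • u) * ballWeight u :=
    integrable_mul_ballWeight (by fun_prop)
  have i5 : ∀ i, Integrable fun u ↦
      fderiv ℝ (fderiv ℝ φ) (x₀ + t • u) (v i) (v i) * ballWeight u :=
    fun i ↦ integrable_mul_ballWeight (by fun_prop)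
  have i6 := integrable_finsetSum Finset.univ fun i _ ↦ i5 i
  have hmono := integral_mono ((i1.add (i2.const_mul (c * t))).add
    (integrable_ballWeight.const_mul (d + V x₀ - W p))) ((i3.add i4).add i6) hpt
  simp only [Pi.add_apply] at hmono
  have el := integral_linear_combination_three i1 i2 integrable_ballWeight 1 (c * t)
    (d + V x₀ - W p)
  have er := integral_linear_combination_three i3 i4 i6 1 1 1
  simp only [one_mul] at el er
  rw [el, er, integral_finsetSum _ fun i _ ↦ i5 i, (hopt y₀).1, ← hJ, ← hN,
    ← inner_gradient_eq_fderiv, ← hp] at hmono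
  have hsum : ∑ i, ∫ u, fderiv ℝ (fderiv ℝ φ) (x₀ + t • u) (v i) (v i) * ballWeight u ≤
      (1 + ε) * N * d := by
    calc _ ≤ ∑ i, (1 + ε) * N * fderiv ℝ (fderiv ℝ φ) x₀ (v i) (v i) :=
          Finset.sum_le_sum fun i _ ↦ (hopt (v i)).2
      _ = _ := by
          rw [← Finset.mul_sum, ← trace_transpose_mul_hessianMatrix_mul, hS1, trace_one,
            Fintype.card_fin]
  have hVm := integral_ray_mul_ballWeight_le h.contDiff_source h.laplacian_source_le x₀ ht
  have hWm := integral_ray_mul_ballWeight_le h.contDiff_conjugate h.laplacian_conjugate_le y₀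
    (by positivity : 0 ≤ c * t)
  rw [← hN, ← hK] at hVm hWm
  have hlow : -(CW + W 0) ≤ ⟪p, y₀⟫ := by
    have e1 := h.young 0 y₀
    have e2 := hW p
    rw [inner_zero_left] at e1
    have e3 : 0 ≤ ‖p‖ ^ 2 := by positivity
    have := (mul_nonneg hb.le e3).trans e2
    linarith
  have hlow' := mul_le_mul_of_nonneg_left hlow (by positivity : 0 ≤ ε * N)
  have hcc : c ^ 2 * Λ' = Λ := by
    rw [hc, div_pow, hR2]; field_simp
  have hcR : c * R = Λ := by rw [hc]; field_simp
  have hsq : (c * t) ^ 2 / 2 * Λ' * K = t ^ 2 / 2 * Λ * K := by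
    linear_combination (t ^ 2 / 2 * K) * hcc
  rw [hsq] at hWm
  have hfin : c * (t * J) ≤ c * (t ^ 2 * K * R + ε * (N * (d + CW + W 0) / c)) := by
    have e1 : c * (t ^ 2 * K * R + ε * (N * (d + CW + W 0) / c)) =
        t ^ 2 * K * Λ + ε * N * (d + CW + W 0) := by
      rw [← hcR]; field_simp
    rw [e1]
    have e2 : N * ⟪p, y₀⟫ = N * (W p + Ws y₀) := by rw [hy₀]
    linarith
  exact le_of_mul_le_mul_left hfin hc0

/-- A bound on the averaged increments at scale `s` propagates to a larger scale `t`. -/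
lemma integral_ray_sub_le_of_le (h : LaplacianBoundedTransport V W Ws φ Λ Λ') {s t b : ℝ}
    (hs : 0 ≤ s) (hst : s < t)
    (hb : ∀ x, (∫ u, φ (x + s • u) * ballWeight u) -
      (∫ u, ballWeight (d := d) u) * φ x ≤ b) (x : EuclideanSpace ℝ (Fin d)) :
    (∫ u, φ (x + t • u) * ballWeight u) - (∫ u, ballWeight (d := d) u) * φ x ≤
      b + (t - s) * t * ((∫ u, ballPotential (d := d) u) * Real.sqrt (Λ * Λ')) := by
  obtain ⟨B, hB⟩ := h.exists_integral_radial_le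
  obtain ⟨m, hm⟩ := exists_superlinear_bound h.one_le_dim h.contDiff_potential
    h.convex_potential h.denseRange_gradient 0 le_rfl
  set N := ∫ u, ballWeight (d := d) u with hN
  set K := ∫ u, ballPotential (d := d) u with hK
  set R := Real.sqrt (Λ * Λ')
  have hN0 : 0 < N := integral_ballWeight_pos
  have ht : 0 < t := hs.trans_lt hst
  have h0 := h.contDiff_potential.continuous
  have h1 := h.contDiff_potential.contDiff_fderiv_of_two.continuous
  have key : ∀ ε : ℝ, 0 < ε → (∫ u, φ (x + t • u) * ballWeight u) - N * φ x ≤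
      b + (t - s) * t * (K * R) + ε * ((t - s) / t * B + N * m + N * φ x) := by
    intro ε hε
    obtain ⟨x₀, hx₀⟩ := h.exists_forall_le_penalized ht.le hε
    have e1 := hB t ε ht.le hε x₀ hx₀
    have e2 := hx₀ x
    have e3 := hb x₀
    have e4 : N * -m ≤ N * φ x₀ := mul_le_mul_of_nonneg_left (by linarith [hm x₀]) hN0.le
    have i1 : Integrable fun u ↦ φ (x₀ + t • u) * ballWeight u :=
      integrable_mul_ballWeight (by fun_prop)
    have i2 : Integrable fun u ↦ φ (x₀ + s • u) * ballWeight u :=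
      integrable_mul_ballWeight (by fun_prop)
    have i3 : Integrable fun u ↦ fderiv ℝ φ (x₀ + t • u) u * ballWeight u :=
      integrable_mul_ballWeight (by fun_prop)
    set J := ∫ u, fderiv ℝ φ (x₀ + t • u) u * ballWeight u with hJ
    have e5 : (∫ u, φ (x₀ + t • u) * ballWeight u) ≤
        1 * (∫ u, φ (x₀ + s • u) * ballWeight u) + (t - s) * J := by
      rw [hJ, ← integral_linear_combination_two i2 i3]
      refine integral_mono i1 ((i2.const_mul 1).add (i3.const_mul (t - s))) fun u ↦ ?_
      have e6 := h.convex_potential.add_fderiv_le h.contDiff_potential (x₀ + t • u) (x₀ + s • u)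
      rw [show x₀ + s • u - (x₀ + t • u) = -((t - s) • u) by rw [sub_smul]; abel, map_neg,
        map_smul, smul_eq_mul] at e6
      have e7 := mul_le_mul_of_nonneg_right e6 (ballWeight_nonneg u)
      simp only
      linarith
    have e8 : (t - s) * J ≤ (t - s) * t * (K * R) + ε * ((t - s) / t * B) := by
      have e9 := mul_le_mul_of_nonneg_left e1 (by positivity : 0 ≤ t⁻¹)
      have e10 := mul_le_mul_of_nonneg_left e9 (sub_nonneg.2 hst.le)
      have e11 : (t - s) * (t⁻¹ * (t * J)) = (t - s) * J := by field_simp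
      have e12 : (t - s) * (t⁻¹ * (t ^ 2 * K * R + ε * B)) =
        (t - s) * t * (K * R) + ε * ((t - s) / t * B) := by field_simp
      rwa [e11, e12] at e10
    have e13 := mul_le_mul_of_nonneg_left e4 hε.le
    linarith
  have hlim : Filter.Tendsto
      (fun ε : ℝ ↦ b + (t - s) * t * (K * R) + ε * ((t - s) / t * B + N * m + N * φ x))
      (nhdsWithin 0 (Set.Ioi 0)) (nhds (b + (t - s) * t * (K * R))) := by
    have hc : Continuous
      (fun ε : ℝ ↦ b + (t - s) * t * (K * R) + ε * ((t - s) / t * B + N * m + N * φ x)) := by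
      fun_prop
    have := hc.tendsto 0
    simp only [zero_mul, add_zero] at this
    exact this.mono_left nhdsWithin_le_nhds
  refine ge_of_tendsto hlim ?_
  filter_upwards [self_mem_nhdsWithin] with ε hε using key ε hε

lemma integral_ray_sub_le_step (h : LaplacianBoundedTransport V W Ws φ Λ Λ') {τ : ℝ} (hτ : 0 < τ)
    (k : ℕ) : ∀ x, (∫ u, φ (x + (k * τ) • u) * ballWeight u) -
      (∫ u, ballWeight (d := d) u) * φ x ≤
      k * (k + 1) / 2 * τ ^ 2 * ((∫ u, ballPotential (d := d) u) * Real.sqrt (Λ * Λ')) := by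
  induction k with
  | zero => intro x; simp [integral_const_mul, mul_comm]
  | succ k ih =>
    intro x
    have h1 := h.integral_ray_sub_le_of_le (s := k * τ) (t := (k + 1 : ℕ) * τ) (by positivity)
      (by push_cast; linarith) ih x
    refine h1.trans (le_of_eq ?_)
    push_cast
    ring

lemma integral_ray_sub_le (h : LaplacianBoundedTransport V W Ws φ Λ Λ') {t : ℝ} (ht : 0 < t)
    (x : EuclideanSpace ℝ (Fin d)) : (∫ u, φ (x + t • u) * ballWeight u) -
      (∫ u, ballWeight (d := d) u) * φ x ≤
      t ^ 2 / 2 * ((∫ u, ballPotential (d := d) u) * Real.sqrt (Λ * Λ')) := by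
  set A := (∫ u, ballPotential (d := d) u) * Real.sqrt (Λ * Λ')
  have key : ∀ n : ℕ, (∫ u, φ (x + t • u) * ballWeight u) -
      (∫ u, ballWeight (d := d) u) * φ x ≤ t ^ 2 / 2 * A * (1 + 1 / ((n : ℝ) + 1)) := by
    intro n
    have hn : (0 : ℝ) < n + 1 := by positivity
    have h1 := h.integral_ray_sub_le_step (τ := t / (n + 1)) (by positivity) (n + 1) x
    have h2 : ((n + 1 : ℕ) : ℝ) * (t / (n + 1)) = t := by push_cast; field_simp
    rw [h2] at h1
    refine h1.trans (le_of_eq ?_)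
    push_cast
    field_simp
    ring
  have hlim : Filter.Tendsto (fun n : ℕ ↦ t ^ 2 / 2 * A * (1 + 1 / ((n : ℝ) + 1))) Filter.atTop
      (nhds (t ^ 2 / 2 * A)) := by
    have := (tendsto_one_div_add_atTop_nhds_zero_nat (𝕜 := ℝ)).const_add 1
    simpa using this.const_mul (t ^ 2 / 2 * A)
  exact ge_of_tendsto' hlim key

/-- The Laplacian bound for the transport potential. -/
theorem laplacian_potential_le (h : LaplacianBoundedTransport V W Ws φ Λ Λ')
    (x : EuclideanSpace ℝ (Fin d)) :
    Laplacian.laplacian φ x ≤ Real.sqrt (Λ * Λ') := by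
  by_contra! hlt
  obtain ⟨R', hR, hR'⟩ := exists_between hlt
  set N := ∫ u, ballWeight (d := d) u with hN
  set K := ∫ u, ballPotential (d := d) u with hK
  have hK0 : 0 < K := integral_ballPotential_pos
  have hφ := h.contDiff_potential
  have hcL := hφ.continuous_laplacian_of_two
  obtain ⟨δ, hδ, hball⟩ := Metric.eventually_nhds_iff.1 ((hcL.tendsto x).eventually_const_lt hR')
  have hder : ∀ t : ℝ, HasDerivAt
      (fun t : ℝ ↦ (∫ u, φ (x + t • u) * ballWeight u) - t ^ 2 / 2 * (K * R'))
      (t * ((∫ u, Laplacian.laplacian φ (x + t • u) * ballPotential u) - K * R')) t := by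
    intro t
    have h1 := hasDerivAt_integral_ray hφ x t
    rw [integral_fderiv_ray_mul_ballWeight hφ] at h1
    refine (h1.sub (((hasDerivAt_pow 2 t).div_const 2).mul_const (K * R'))).congr_deriv ?_
    push_cast
    ring
  set T := δ / 2 with hT
  have hT0 : 0 < T := by positivity
  have hmono : MonotoneOn
      (fun t : ℝ ↦ (∫ u, φ (x + t • u) * ballWeight u) - t ^ 2 / 2 * (K * R')) (Set.Icc 0 T) := by
    refine monotoneOn_of_deriv_nonneg (convex_Icc 0 T)
      (fun t _ ↦ (hder t).continuousAt.continuousWithinAt)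
      (fun t _ ↦ (hder t).differentiableAt.differentiableWithinAt) fun t ht ↦ ?_
    rw [interior_Icc] at ht
    rw [(hder t).deriv]
    refine mul_nonneg ht.1.le (sub_nonneg.2 ?_)
    rw [hK, ← integral_mul_const]
    refine integral_mono (integrable_ballPotential.mul_const R')
      (integrable_mul_ballPotential (by fun_prop)) fun u ↦ ?_
    simp only
    rcases le_total 1 ‖u‖ with hu | hu
    · simp [ballPotential_eq_zero hu]
    · rw [mul_comm]
      refine mul_le_mul_of_nonneg_right (hball ?_).le (ballPotential_nonneg u)
      rw [dist_eq_norm, add_sub_cancel_left, norm_smul, Real.norm_of_nonneg ht.1.le]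
      nlinarith [ht.2, ht.1, norm_nonneg u]
  have h1 := hmono (Set.left_mem_Icc.2 hT0.le) (Set.right_mem_Icc.2 hT0.le) hT0.le
  have h2 := h.integral_ray_sub_le hT0 x
  simp only [zero_smul, add_zero, integral_const_mul, ← hN] at h1
  rw [← hN, ← hK] at h2
  have h3 : T ^ 2 / 2 * (K * Real.sqrt (Λ * Λ')) < T ^ 2 / 2 * (K * R') := by gcongr
  linarith

end LaplacianBoundedTransport

section MongeAmpere

variable {d : ℕ} {φ : EuclideanSpace ℝ (Fin d) → ℝ}

/-- The derivative of the gradient of `φ`, as a continuous linear map. -/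
noncomputable def hessianCLM (φ : EuclideanSpace ℝ (Fin d) → ℝ) (x : EuclideanSpace ℝ (Fin d)) :
    EuclideanSpace ℝ (Fin d) →L[ℝ] EuclideanSpace ℝ (Fin d) :=
  (InnerProductSpace.toDual ℝ (EuclideanSpace ℝ (Fin d))).symm.toContinuousLinearEquiv.toContinuousLinearMap
    ∘L fderiv ℝ (fderiv ℝ φ) x

lemma hasFDerivAt_gradient (hφ : ContDiff ℝ 2 φ) (x : EuclideanSpace ℝ (Fin d)) :
    HasFDerivAt (gradient φ) (hessianCLM φ x) x :=
  ((InnerProductSpace.toDual ℝ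
    (EuclideanSpace ℝ (Fin d))).symm.toContinuousLinearEquiv.toContinuousLinearMap.hasFDerivAt).comp x
    (hφ.hasFDerivAt_fderiv_of_two x)

lemma inner_hessianCLM (φ : EuclideanSpace ℝ (Fin d) → ℝ) (x v w : EuclideanSpace ℝ (Fin d)) :
    ⟪hessianCLM φ x v, w⟫ = fderiv ℝ (fderiv ℝ φ) x v w := by
  rw [hessianCLM, ← InnerProductSpace.toDual_apply_apply (𝕜 := ℝ)]
  simp

lemma det_hessianCLM (φ : EuclideanSpace ℝ (Fin d) → ℝ) (x : EuclideanSpace ℝ (Fin d)) :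
    (hessianCLM φ x).det = (hessianMatrix φ x).det := by
  rw [ContinuousLinearMap.det,
    ← LinearMap.det_toMatrix (EuclideanSpace.basisFun (Fin d) ℝ).toBasis, ← det_transpose]
  congr 1
  ext i j
  rw [transpose_apply, LinearMap.toMatrix_apply, hessianMatrix_apply, ← inner_hessianCLM]
  simp [EuclideanSpace.inner_single_right]

lemma continuous_det_hessianMatrix (hφ : ContDiff ℝ 2 φ) :
    Continuous fun x ↦ (hessianMatrix φ x).det := by
  have h2 := hφ.continuous_fderiv_fderiv_of_two
  refine Continuous.matrix_det (continuous_matrix fun i j ↦ ?_)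
  simp only [hessianMatrix_apply]
  fun_prop

lemma isHermitian_hessianMatrix (hφ : ContDiff ℝ 2 φ) (x : EuclideanSpace ℝ (Fin d)) :
    (hessianMatrix φ x).IsHermitian := by
  ext i j
  have h : IsSymmSndFDerivAt ℝ φ x := hφ.contDiffAt.isSymmSndFDerivAt (by simp)
  simp only [conjTranspose_apply, star_trivial, hessianMatrix_apply]
  exact h _ _

lemma ConvexOn.monotone_fderiv_ray (hc : ConvexOn ℝ Set.univ φ) (hφ : ContDiff ℝ 2 φ)
    (x v : EuclideanSpace ℝ (Fin d)) : Monotone fun s : ℝ ↦ fderiv ℝ φ (x + s • v) v := by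
  intro s t hst
  rcases hst.eq_or_lt with rfl | hlt
  · exact le_rfl
  have h1 := hc.add_fderiv_le hφ (x + s • v) (x + t • v)
  have h2 := hc.add_fderiv_le hφ (x + t • v) (x + s • v)
  rw [show x + t • v - (x + s • v) = (t - s) • v by rw [sub_smul]; abel, map_smul,
    smul_eq_mul] at h1
  rw [show x + s • v - (x + t • v) = -((t - s) • v) by rw [sub_smul]; abel, map_neg, map_smul,
    smul_eq_mul] at h2
  refine le_of_mul_le_mul_left ?_ (sub_pos.2 hlt)
  linarith

lemma ConvexOn.posSemidef_hessianMatrix (hc : ConvexOn ℝ Set.univ φ) (hφ : ContDiff ℝ 2 φ)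
    (x : EuclideanSpace ℝ (Fin d)) : (hessianMatrix φ x).PosSemidef := by
  refine PosSemidef.of_dotProduct_mulVec_nonneg (isHermitian_hessianMatrix hφ x) fun v ↦ ?_
  have h1 := (hc.monotone_fderiv_ray hφ x (WithLp.toLp 2 v)).deriv_nonneg (x := 0)
  rw [(hφ.hasDerivAt_fderiv_ray x _ _ 0).deriv, zero_smul, add_zero,
    fderiv_fderiv_eq_dotProduct] at h1
  simpa using h1

lemma ConvexOn.posDef_hessianMatrix (hc : ConvexOn ℝ Set.univ φ) (hφ : ContDiff ℝ 2 φ)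
    {x : EuclideanSpace ℝ (Fin d)} (hx : (hessianMatrix φ x).det ≠ 0) :
    (hessianMatrix φ x).PosDef :=
  (hc.posSemidef_hessianMatrix hφ x).posDef_iff_isUnit.2
    ((isUnit_iff_isUnit_det _).2 (isUnit_iff_ne_zero.2 hx))

/-- A nondegenerate point is the only preimage of its image under the gradient map. -/
lemma ConvexOn.eq_of_gradient_eq (hc : ConvexOn ℝ Set.univ φ) (hφ : ContDiff ℝ 2 φ)
    {x y : EuclideanSpace ℝ (Fin d)} (hx : (hessianMatrix φ x).det ≠ 0)
    (hxy : gradient φ x = gradient φ y) : x = y := by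
  by_contra hne
  set v := y - x with hv
  have hv0 : v.ofLp ≠ 0 := fun h ↦ hne (sub_eq_zero.1 ((WithLp.ofLp_eq_zero 2).1 h)).symm
  have hpos := (hc.posDef_hessianMatrix hφ hx).dotProduct_mulVec_pos hv0
  rw [star_trivial, ← fderiv_fderiv_eq_dotProduct] at hpos
  have hmono := hc.monotone_fderiv_ray hφ x v
  have hends : fderiv ℝ φ (x + (0 : ℝ) • v) v = fderiv ℝ φ (x + (1 : ℝ) • v) v := by
    rw [zero_smul, add_zero, one_smul, hv, add_sub_cancel, ← inner_gradient_eq_fderiv,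
      ← inner_gradient_eq_fderiv, hxy]
  have h1 := (hφ.hasDerivAt_fderiv_ray x v v 0).hasDerivWithinAt (s := Set.Icc 0 1)
  rw [zero_smul, add_zero] at h1
  have h2 : HasDerivWithinAt (fun s : ℝ ↦ fderiv ℝ φ (x + s • v) v) 0 (Set.Icc 0 1) 0 := by
    refine (hasDerivWithinAt_const (0 : ℝ) (Set.Icc 0 1)
      (fderiv ℝ φ (x + (0 : ℝ) • v) v)).congr (fun s hs ↦ ?_) rfl
    exact le_antisymm (hends ▸ hmono hs.2) (hmono hs.1)
  have h3 := (uniqueDiffOn_Icc zero_lt_one (0 : ℝ) (by simp)).eq_deriv _ h1 h2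
  exact hpos.ne' h3

variable {V W : EuclideanSpace ℝ (Fin d) → ℝ}

/-- The change of variables formula for the transport map, in integrated form. -/
lemma withDensity_eq_of_map_gradient_eq (hφ : ContDiff ℝ 2 φ) (hc : ConvexOn ℝ Set.univ φ)
    (hpush : Measure.map (gradient φ)
        (volume.withDensity fun x ↦ ENNReal.ofReal (Real.exp (-V x))) =
      volume.withDensity fun x ↦ ENNReal.ofReal (Real.exp (-W x))) :
    (volume.withDensity fun x ↦ ENNReal.ofReal (Real.exp (-V x))) =
      volume.withDensity fun x ↦ ENNReal.ofReal |(hessianMatrix φ x).det| *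
        ENNReal.ofReal (Real.exp (-W (gradient φ x))) := by
  have hg := hφ.continuous_gradient_of_two
  have hdetc := continuous_det_hessianMatrix hφ
  set μ := volume.withDensity fun x ↦ ENNReal.ofReal (Real.exp (-V x)) with hμ
  set ν := volume.withDensity fun x ↦ ENNReal.ofReal (Real.exp (-W x)) with hν
  set Z := {x | (hessianMatrix φ x).det = 0} with hZ
  have hZm : MeasurableSet Z := (isClosed_singleton.preimage hdetc).measurableSet
  have hnull : μ Z = 0 := by
    have h1 : volume (gradient φ '' Z) = 0 :=
      addHaar_image_eq_zero_of_det_fderivWithin_eq_zero volume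
        (fun x _ ↦ (hasFDerivAt_gradient hφ x).hasFDerivWithinAt)
        (fun x hx ↦ (det_hessianCLM φ x).trans hx)
    have h2 : ν (gradient φ '' Z) = 0 := withDensity_absolutelyContinuous _ _ h1
    rw [← hpush] at h2
    exact measure_mono_null (Set.subset_preimage_image _ _)
      (Measure.preimage_null_of_map_null hg.aemeasurable h2)
  ext B hB
  rw [← measure_sdiff_null (s := B) hnull]
  have hBZ : MeasurableSet (B \ Z) := hB.diff hZm
  have hinj : Set.InjOn (gradient φ) (B \ Z) := fun x hx y _ hxy ↦
    hc.eq_of_gradient_eq hφ hx.2 hxy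
  have hder : ∀ x ∈ B \ Z, HasFDerivWithinAt (gradient φ) (hessianCLM φ x) (B \ Z) x :=
    fun x _ ↦ (hasFDerivAt_gradient hφ x).hasFDerivWithinAt
  have himg : MeasurableSet (gradient φ '' (B \ Z)) := measurable_image_of_fderivWithin hBZ hder hinj
  have hpre : gradient φ ⁻¹' (gradient φ '' (B \ Z)) = B \ Z := by
    refine Set.Subset.antisymm ?_ (Set.subset_preimage_image _ _)
    rintro y ⟨x, hx, hxy⟩
    rwa [← hc.eq_of_gradient_eq hφ hx.2 hxy]
  have h1 : μ (B \ Z) = ν (gradient φ '' (B \ Z)) := by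
    rw [← hpush, Measure.map_apply hg.measurable himg, hpre]
  rw [h1, hν, withDensity_apply _ himg,
    lintegral_image_eq_lintegral_abs_det_fderiv_mul volume hBZ hder hinj,
    withDensity_apply _ hB, ← lintegral_inter_add_sdiff _ B hZm]
  simp only [det_hessianCLM]
  rw [setLIntegral_congr_fun (s := B ∩ Z) (hB.inter hZm) (g := 0), lintegral_zero_fun, zero_add]
  intro x hx
  have : (hessianMatrix φ x).det = 0 := hx.2
  simp [this]

/-- A `C²` Brenier map solves the Monge–Ampère equation pointwise. -/
lemma exp_neg_eq_of_map_gradient_eq (hV : Continuous V) (hW : Continuous W)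
    (hφ : ContDiff ℝ 2 φ) (hc : ConvexOn ℝ Set.univ φ)
    (hfin : IsFiniteMeasure (volume.withDensity fun x ↦ ENNReal.ofReal (Real.exp (-V x))))
    (hpush : Measure.map (gradient φ)
        (volume.withDensity fun x ↦ ENNReal.ofReal (Real.exp (-V x))) =
      volume.withDensity fun x ↦ ENNReal.ofReal (Real.exp (-W x)))
    (x : EuclideanSpace ℝ (Fin d)) :
    Real.exp (-V x) = |(hessianMatrix φ x).det| * Real.exp (-W (gradient φ x)) := by
  have hg := hφ.continuous_gradient_of_two
  have hdetc := continuous_det_hessianMatrix hφ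
  have hfin' : ∫⁻ x, ENNReal.ofReal (Real.exp (-V x)) ≠ ⊤ := by
    have := measure_ne_top (volume.withDensity fun x ↦ ENNReal.ofReal (Real.exp (-V x))) Set.univ
    rwa [withDensity_apply _ MeasurableSet.univ, setLIntegral_univ] at this
  have hm1 : Measurable fun x ↦ ENNReal.ofReal (Real.exp (-V x)) :=
    (Real.continuous_exp.comp hV.neg).measurable.ennreal_ofReal
  have hm2 : Measurable fun x ↦ ENNReal.ofReal |(hessianMatrix φ x).det| *
      ENNReal.ofReal (Real.exp (-W (gradient φ x))) :=
    hdetc.abs.measurable.ennreal_ofReal.mul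
      (Real.continuous_exp.comp (hW.comp hg).neg).measurable.ennreal_ofReal
  have hae := (withDensity_eq_iff hm1.aemeasurable hm2.aemeasurable hfin').1
    (withDensity_eq_of_map_gradient_eq hφ hc hpush)
  have hae' : (fun x ↦ Real.exp (-V x)) =ᵐ[volume]
      fun x ↦ |(hessianMatrix φ x).det| * Real.exp (-W (gradient φ x)) := by
    filter_upwards [hae] with y hy
    rw [← ENNReal.ofReal_mul (abs_nonneg _)] at hy
    exact (ENNReal.ofReal_eq_ofReal_iff (by positivity) (by positivity)).1 hy
  have := (Continuous.ae_eq_iff_eq volume (Real.continuous_exp.comp hV.neg)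
    (hdetc.abs.mul (Real.continuous_exp.comp (hW.comp hg).neg))).1 hae'
  exact congrFun this x

lemma denseRange_of_map_eq_withDensity {T : EuclideanSpace ℝ (Fin d) → EuclideanSpace ℝ (Fin d)}
    (hT : Continuous T) (hW : Continuous W) {μ : Measure (EuclideanSpace ℝ (Fin d))}
    (hpush : Measure.map T μ = volume.withDensity fun x ↦ ENNReal.ofReal (Real.exp (-W x))) :
    DenseRange T := by
  intro y
  rw [Metric.mem_closure_range_iff]
  intro ε hε
  by_contra! hfar
  have h1 : Measure.map T μ (Metric.ball y ε) = 0 := by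
    rw [Measure.map_apply hT.measurable Metric.isOpen_ball.measurableSet]
    convert measure_empty (μ := μ)
    ext x
    simpa [dist_comm] using hfar x
  rw [hpush] at h1
  have h2 : volume (Metric.ball y ε) = 0 :=
    withDensity_absolutelyContinuous' (by fun_prop) (by simp [Real.exp_pos]) h1
  exact (Metric.measure_ball_pos volume y hε).ne' h2

end MongeAmpere

section LinearChange

variable {d : ℕ}

lemma toEuclideanCLM_apply_of_mul_eq_one {A B : Matrix (Fin d) (Fin d) ℝ} (h : A * B = 1)
    (x : EuclideanSpace ℝ (Fin d)) :
    toEuclideanCLM (𝕜 := ℝ) A (toEuclideanCLM (𝕜 := ℝ) B x) = x := by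
  ext i
  simp [ofLp_toEuclideanCLM, mulVec_mulVec, h]

lemma inner_toEuclideanCLM_transpose (A : Matrix (Fin d) (Fin d) ℝ)
    (x y : EuclideanSpace ℝ (Fin d)) :
    ⟪toEuclideanCLM (𝕜 := ℝ) Aᵀ x, y⟫ = ⟪x, toEuclideanCLM (𝕜 := ℝ) A y⟫ := by
  rw [real_inner_comm, inner_toEuclideanCLM, inner_toEuclideanCLM, mulVec_transpose,
    dotProduct_comm, dotProduct_mulVec]

variable {f : EuclideanSpace ℝ (Fin d) → ℝ}

lemma ContDiff.fderiv_comp_toEuclideanCLM (hf : ContDiff ℝ 2 f) (A : Matrix (Fin d) (Fin d) ℝ)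
    (w : EuclideanSpace ℝ (Fin d)) :
    fderiv ℝ (fun z ↦ f (toEuclideanCLM (𝕜 := ℝ) A z)) w =
      (fderiv ℝ f (toEuclideanCLM (𝕜 := ℝ) A w)).comp (toEuclideanCLM (𝕜 := ℝ) A) :=
  ((hf.hasFDerivAt_of_two _).comp w (toEuclideanCLM (𝕜 := ℝ) A).hasFDerivAt).fderiv

lemma ContDiff.fderiv_fderiv_comp_toEuclideanCLM (hf : ContDiff ℝ 2 f)
    (A : Matrix (Fin d) (Fin d) ℝ) (w u v : EuclideanSpace ℝ (Fin d)) :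
    fderiv ℝ (fderiv ℝ fun z ↦ f (toEuclideanCLM (𝕜 := ℝ) A z)) w u v =
      fderiv ℝ (fderiv ℝ f) (toEuclideanCLM (𝕜 := ℝ) A w) (toEuclideanCLM (𝕜 := ℝ) A u)
        (toEuclideanCLM (𝕜 := ℝ) A v) := by
  rw [funext (hf.fderiv_comp_toEuclideanCLM A)]
  have h := ((hf.hasFDerivAt_fderiv_of_two (toEuclideanCLM (𝕜 := ℝ) A w)).comp w
    (toEuclideanCLM (𝕜 := ℝ) A).hasFDerivAt).clm_comp
    (hasFDerivAt_const (toEuclideanCLM (𝕜 := ℝ) A) w)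
  simp only [Function.comp_def] at h
  rw [h.fderiv]
  simp

lemma ContDiff.hessianMatrix_comp_toEuclideanCLM (hf : ContDiff ℝ 2 f)
    (A : Matrix (Fin d) (Fin d) ℝ) (w : EuclideanSpace ℝ (Fin d)) :
    hessianMatrix (fun z ↦ f (toEuclideanCLM (𝕜 := ℝ) A z)) w =
      Aᵀ * hessianMatrix f (toEuclideanCLM (𝕜 := ℝ) A w) * A := by
  ext i j
  rw [hessianMatrix_apply, hf.fderiv_fderiv_comp_toEuclideanCLM, fderiv_fderiv_eq_dotProduct,
    Matrix.mul_assoc]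
  simp [ofLp_toEuclideanCLM, Matrix.mul_apply, dotProduct, mulVec]

lemma ContDiff.gradient_comp_toEuclideanCLM (hf : ContDiff ℝ 2 f)
    (A : Matrix (Fin d) (Fin d) ℝ) (w : EuclideanSpace ℝ (Fin d)) :
    gradient (fun z ↦ f (toEuclideanCLM (𝕜 := ℝ) A z)) w =
      toEuclideanCLM (𝕜 := ℝ) Aᵀ (gradient f (toEuclideanCLM (𝕜 := ℝ) A w)) := by
  refine ext_inner_right ℝ fun v ↦ ?_
  rw [inner_gradient_eq_fderiv, hf.fderiv_comp_toEuclideanCLM, inner_toEuclideanCLM_transpose,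
    inner_gradient_eq_fderiv]
  rfl

lemma ContDiff.laplacian_comp_toEuclideanCLM (hf : ContDiff ℝ 2 f)
    (A : Matrix (Fin d) (Fin d) ℝ) (w : EuclideanSpace ℝ (Fin d)) :
    Laplacian.laplacian (fun z ↦ f (toEuclideanCLM (𝕜 := ℝ) A z)) w =
      frob (hessianMatrix f (toEuclideanCLM (𝕜 := ℝ) A w)) (A * Aᵀ) := by
  rw [laplacian_eq_trace_hessianMatrix, hf.hessianMatrix_comp_toEuclideanCLM, frob,
    transpose_mul, transpose_transpose, Matrix.mul_assoc, trace_mul_comm, Matrix.mul_assoc,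
    trace_mul_comm]

lemma integrable_comp_toEuclideanCLM {A : Matrix (Fin d) (Fin d) ℝ} (hA : A.det ≠ 0)
    (hf : Integrable f) : Integrable fun w ↦ f (toEuclideanCLM (𝕜 := ℝ) A w) := by
  have hdet : LinearMap.det
      (toEuclideanCLM (𝕜 := ℝ) A : EuclideanSpace ℝ (Fin d) →ₗ[ℝ] EuclideanSpace ℝ (Fin d)) ≠ 0 := by
    rw [coe_toEuclideanCLM_eq_toEuclideanLin]
    simpa [toEuclideanLin] using hA
  have hmap := Measure.map_linearMap_addHaar_eq_smul_addHaar
    (volume : Measure (EuclideanSpace ℝ (Fin d))) hdet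
  have h1 : Integrable f (Measure.map (toEuclideanCLM (𝕜 := ℝ) A) volume) := by
    rw [show Measure.map (toEuclideanCLM (𝕜 := ℝ) A) (volume : Measure (EuclideanSpace ℝ (Fin d)))
      = _ from hmap]
    exact hf.smul_measure ENNReal.ofReal_ne_top
  exact h1.comp_measurable (toEuclideanCLM (𝕜 := ℝ) A).continuous.measurable

lemma laplacian_sub_const (f : EuclideanSpace ℝ (Fin d) → ℝ) (c : ℝ)
    (x : EuclideanSpace ℝ (Fin d)) :
    Laplacian.laplacian (fun z ↦ f z - c) x = Laplacian.laplacian f x := by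
  simp only [laplacian_eq_sum_fderiv]
  rw [show fderiv ℝ (fun z ↦ f z - c) = fderiv ℝ f from funext fun z ↦ fderiv_sub_const c]

end LinearChange

lemma integrable_exp_neg_of_isFiniteMeasure {E : Type*} [MeasureSpace E] [TopologicalSpace E]
    [OpensMeasurableSpace E] {V : E → ℝ} (hV : Continuous V)
    (hfin : IsFiniteMeasure
      ((volume : Measure E).withDensity fun x ↦ ENNReal.ofReal (Real.exp (-V x)))) :
    Integrable fun x ↦ Real.exp (-V x) := by
  have hm : Measurable fun x ↦ Real.exp (-V x) := (Real.continuous_exp.comp hV.neg).measurable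
  refine ⟨hm.aestronglyMeasurable, ?_⟩
  rw [hasFiniteIntegral_iff_ofReal (Filter.Eventually.of_forall fun x ↦ (Real.exp_pos _).le)]
  have h := measure_lt_top
    ((volume : Measure E).withDensity fun x ↦ ENNReal.ofReal (Real.exp (-V x))) Set.univ
  rwa [withDensity_apply _ MeasurableSet.univ, Measure.restrict_univ] at h

lemma LaplacianBoundedTransport.of_linear_change {d : ℕ} (hd : 1 ≤ d)
    {A : Matrix (Fin d) (Fin d) ℝ} (hA : IsUnit A)
    {V W Ws φ : EuclideanSpace ℝ (Fin d) → ℝ}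
    (hV : ContDiff ℝ 2 V) (hW : ContDiff ℝ 2 W) (hWs : ContDiff ℝ 2 Ws)
    (hWc : ConvexOn ℝ Set.univ W)
    (hlub : ∀ y : EuclideanSpace ℝ (Fin d),
      IsLUB {z : ℝ | ∃ x : EuclideanSpace ℝ (Fin d), z = ⟪x, y⟫ - W x} (Ws y))
    (hfin : IsFiniteMeasure (volume.withDensity fun x ↦ ENNReal.ofReal (Real.exp (-V x))))
    {Λ Λ' : ℝ} (hΛ : 0 < Λ) (hΛ' : 0 < Λ')
    (hVb : ∀ x, frob (hessianMatrix V x) (A * Aᵀ) ≤ Λ)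
    (hWb : ∀ x, frob (hessianMatrix Ws x) (A * Aᵀ) ≤ Λ')
    (hφ : ContDiff ℝ 2 φ) (hφc : ConvexOn ℝ Set.univ φ)
    (hpush : Measure.map (gradient φ)
        (volume.withDensity fun x ↦ ENNReal.ofReal (Real.exp (-V x))) =
      volume.withDensity fun x ↦ ENNReal.ofReal (Real.exp (-W x))) :
    LaplacianBoundedTransport
      (fun w ↦ V (toEuclideanCLM (𝕜 := ℝ) A w) - Real.log (A.det ^ 2))
      (fun q ↦ W (toEuclideanCLM (𝕜 := ℝ) A⁻¹ᵀ q))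
      (fun y ↦ Ws (toEuclideanCLM (𝕜 := ℝ) A y))
      (fun w ↦ φ (toEuclideanCLM (𝕜 := ℝ) A w)) Λ Λ' := by
  have hdet : A.det ≠ 0 := ((isUnit_iff_isUnit_det A).1 hA).ne_zero
  have hr : A * A⁻¹ = 1 := mul_nonsing_inv A ((isUnit_iff_isUnit_det A).1 hA)
  have hl : A⁻¹ * A = 1 := nonsing_inv_mul A ((isUnit_iff_isUnit_det A).1 hA)
  have hr' : Aᵀ * A⁻¹ᵀ = 1 := by rw [← transpose_mul, hl, transpose_one]
  have hl' : A⁻¹ᵀ * Aᵀ = 1 := by rw [← transpose_mul, hr, transpose_one]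
  have hinner (q y : EuclideanSpace ℝ (Fin d)) :
      ⟪toEuclideanCLM (𝕜 := ℝ) A⁻¹ᵀ q, toEuclideanCLM (𝕜 := ℝ) A y⟫ = ⟪q, y⟫ := by
    rw [inner_toEuclideanCLM_transpose, toEuclideanCLM_apply_of_mul_eq_one hl]
  have hLc : ContDiff ℝ 2 (toEuclideanCLM (𝕜 := ℝ) A) := (toEuclideanCLM (𝕜 := ℝ) A).contDiff
  have hexp := exp_neg_eq_of_map_gradient_eq hV.continuous hW.continuous hφ hφc hfin hpush
  have hdetφ (x) : (hessianMatrix φ x).det ≠ 0 := fun h0 ↦ by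
    have h1 := hexp x
    rw [h0, abs_zero, zero_mul] at h1
    exact (Real.exp_pos _).ne' h1
  have hφ' : ContDiff ℝ 2 fun w ↦ φ (toEuclideanCLM (𝕜 := ℝ) A w) := hφ.comp hLc
  have hφc' : ConvexOn ℝ Set.univ fun w ↦ φ (toEuclideanCLM (𝕜 := ℝ) A w) :=
    hφc.comp_linearMap (toEuclideanCLM (𝕜 := ℝ) A).toLinearMap
  have hdet' (w) : (hessianMatrix (fun w ↦ φ (toEuclideanCLM (𝕜 := ℝ) A w)) w).det =
      A.det ^ 2 * (hessianMatrix φ (toEuclideanCLM (𝕜 := ℝ) A w)).det := by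
    rw [hφ.hessianMatrix_comp_toEuclideanCLM, det_mul, det_mul, det_transpose]
    ring
  refine ⟨hd, (hV.comp hLc).sub contDiff_const, hWs.comp hLc, hφ', hφc', ?_, fun q y ↦ ?_,
    fun q ↦ ?_, hΛ, hΛ', fun x ↦ ?_, fun y ↦ ?_, fun x ↦ ?_, fun x ↦ ?_, ?_⟩
  · have h := (integrable_comp_toEuclideanCLM hdet
      (integrable_exp_neg_of_isFiniteMeasure hV.continuous hfin)).const_mul
      (Real.exp (Real.log (A.det ^ 2)))
    refine h.congr (Filter.Eventually.of_forall fun w ↦ ?_)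
    simp only [← Real.exp_add]
    ring_nf
  · have h := (hlub (toEuclideanCLM (𝕜 := ℝ) A y)).1
      ⟨toEuclideanCLM (𝕜 := ℝ) A⁻¹ᵀ q, rfl⟩
    rw [hinner] at h
    linarith
  · set p := toEuclideanCLM (𝕜 := ℝ) A⁻¹ᵀ q
    refine ⟨toEuclideanCLM (𝕜 := ℝ) A⁻¹ (gradient W p), ?_⟩
    rw [← hinner q, toEuclideanCLM_apply_of_mul_eq_one hr]
    refine le_antisymm ?_ ?_
    · have h : Ws (gradient W p) ≤ ⟪p, gradient W p⟫ - W p := by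
        refine (hlub _).2 ?_
        rintro _ ⟨x, rfl⟩
        have h1 := hWc.add_fderiv_le hW p x
        rw [← inner_gradient_eq_fderiv, inner_sub_right] at h1
        rw [real_inner_comm, real_inner_comm (gradient W p) p]
        linarith
      linarith
    · have h := (hlub (gradient W p)).1 ⟨p, rfl⟩
      linarith
  · rw [laplacian_sub_const, hV.laplacian_comp_toEuclideanCLM]
    exact hVb _
  · rw [hWs.laplacian_comp_toEuclideanCLM]
    exact hWb _
  · refine hφc'.posDef_hessianMatrix hφ' ?_
    rw [hdet']
    exact mul_ne_zero (pow_ne_zero 2 hdet) (hdetφ _)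
  · rw [hdet', Real.log_mul (pow_ne_zero 2 hdet) (hdetφ _), hφ.gradient_comp_toEuclideanCLM,
      toEuclideanCLM_apply_of_mul_eq_one hl']
    have h := congrArg Real.log (hexp (toEuclideanCLM (𝕜 := ℝ) A x))
    rw [Real.log_exp, Real.log_mul (abs_ne_zero.2 (hdetφ _)) (Real.exp_pos _).ne', Real.log_exp,
      Real.log_abs] at h
    linarith
  · have hsurj : Function.Surjective (toEuclideanCLM (n := Fin d) (𝕜 := ℝ) A) :=
      fun x ↦ ⟨_, toEuclideanCLM_apply_of_mul_eq_one hr x⟩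
    have hsurj' : Function.Surjective (toEuclideanCLM (n := Fin d) (𝕜 := ℝ) Aᵀ) :=
      fun x ↦ ⟨_, toEuclideanCLM_apply_of_mul_eq_one hr' x⟩
    have hg := hφ.continuous_gradient_of_two
    rw [show gradient (fun w ↦ φ (toEuclideanCLM (𝕜 := ℝ) A w)) =
      toEuclideanCLM (𝕜 := ℝ) Aᵀ ∘ gradient φ ∘ toEuclideanCLM (𝕜 := ℝ) A from
        funext (hφ.gradient_comp_toEuclideanCLM A)]
    exact hsurj'.denseRange.comp ((denseRange_of_map_eq_withDensity hg hW.continuous hpush).comp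
      hsurj.denseRange hg) (toEuclideanCLM (𝕜 := ℝ) Aᵀ).continuous

/-- Anisotropic Laplacian bound: if `⟨∇²V, Y⟩ ≤ Λ_V` and `⟨∇²W*, Y⟩ ≤ 1/λ_W`
for a symmetric positive definite `Y`, then the Brenier map `∇φ` from
`μ = e^{-V}dx` to `ν = e^{-W}dx` satisfies `⟨∇²φ, Y⟩ ≤ √(Λ_V/λ_W)`. -/
theorem anisotropic_laplacian_bound_brenier {d : ℕ} (hd : 1 ≤ d)
    (Y : Matrix (Fin d) (Fin d) ℝ) (hY : Y.PosDef)
    (V W Wstar : EuclideanSpace ℝ (Fin d) → ℝ)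
    (hV : ContDiff ℝ 2 V) (hW : ContDiff ℝ 2 W) (hWstar : ContDiff ℝ 2 Wstar)
    (hWconv : ConvexOn ℝ Set.univ W)
    (hLegendre : ∀ y : EuclideanSpace ℝ (Fin d),
      IsLUB {z : ℝ | ∃ x : EuclideanSpace ℝ (Fin d), z = ⟪x, y⟫ - W x} (Wstar y))
    (μ ν : Measure (EuclideanSpace ℝ (Fin d)))
    (hμ : μ = volume.withDensity fun x => ENNReal.ofReal (Real.exp (-V x)))
    (hν : ν = volume.withDensity fun x => ENNReal.ofReal (Real.exp (-W x)))
    (hμprob : IsProbabilityMeasure μ) (hνprob : IsProbabilityMeasure ν)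
    (ΛV lamW : ℝ) (hΛV : 0 < ΛV) (hlamW : 0 < lamW)
    (hVbound : ∀ x, frob (hessianMatrix V x) Y ≤ ΛV)
    (hWstarbound : ∀ x, frob (hessianMatrix Wstar x) Y ≤ 1 / lamW)
    (φ : EuclideanSpace ℝ (Fin d) → ℝ)
    (hφ : ContDiff ℝ 2 φ) (hφconv : ConvexOn ℝ Set.univ φ)
    (hpush : Measure.map (fun x => gradient φ x) μ = ν) :
    ∀ x, frob (hessianMatrix φ x) Y ≤ Real.sqrt (ΛV / lamW) := by
  intro x
  subst hμ hν
  obtain ⟨A, hA, rfl⟩ := hY.exists_eq_mul_transpose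
  have h := (LaplacianBoundedTransport.of_linear_change hd hA hV hW hWstar hWconv hLegendre
    inferInstance hΛV (one_div_pos.2 hlamW) hVbound hWstarbound hφ hφconv
    hpush).laplacian_potential_le (toEuclideanCLM (𝕜 := ℝ) A⁻¹ x)
  rwa [hφ.laplacian_comp_toEuclideanCLM, toEuclideanCLM_apply_of_mul_eq_one
    (mul_nonsing_inv A ((isUnit_iff_isUnit_det A).1 hA)), mul_one_div] at h
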